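/- Let $m,n\ge 0$ be integers, $[n]=\{1,\dots,n\}$, and write $[a;b]$ for the set of integers $k$ with $a\le k\le b$. The $m$-Catalan arrangement $\mathcal A_m^n$ is the set of hyperplanes $\{x\in\mathbb R^n: x_i-x_j=s\}$ with $1\le i<j\le n$ and $s\in[-m;m]$. Let $\mathrm{Tr}_m^n$ be the set of triples $(i,j,s)$ with $i,j\in[n]$, $i\ne j$, $s\in[0;m]$ and ($s>0$ or $i>j$), and for $\mathcal A\subseteq\mathcal A_m^n$ let $\mathrm{Tr}_m^n(\mathcal A)$ be the set of those $(i,j,s)\in \mathrm{Tr}_m^n$ with $\{x_i-x_j=s\}\in\mathcal A$. The arrangement $\mathcal A$ is *strongly transitive* if for all distinct $i,j,k\in[n]$ and all integers $s,t\ge 0$: if $\{x_i-x_j=s\}\notin\mathcal A$ and $\{x_j-x_k=t\}\notin\mathcal A$, then $\{x_i-x_k=s+t\}\notin\mathcal A$. *Trees.* An $(m,n)$-tree $T$ is a rooted $(m+1)$-ary tree with $n$ internal nodes labeled bijectively by $[n]$ (the leaves are unlabeled); nodes are identified with their labels, and the ordered children of a node $j$ are denoted $0\text{-child}(j),\dots,m\text{-child}(j)$.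 A node $i$ is the $s$-cadet of a node $j$ if $i=s\text{-child}(j)$ and $t\text{-child}(j)$ is a leaf for all $t\in[s+1;m]$; then $\{i,j\}$ is a *cadet edge*. If $v_0,\dots,v_k=v$ is the path from the root $v_0$ to a vertex $v$ (node or leaf), with $v_p=s_p\text{-child}(v_{p-1})$, set $\mathrm{path}_T(v)=(s_1,\dots,s_k)$ and $\mathrm{drift}_T(v)=s_1+\dots+s_k$. The total order $\preceq_T$ on the vertices is defined as follows: for *distinct* vertices $v,w$ with $\mathrm{path}_T(v)=(s_1,\dots,s_k)$ and $\mathrm{path}_T(w)=(t_1,\dots,t_\ell)$, one has $v\prec_T w$ if and only if $\mathrm{drift}_T(v)<\mathrm{drift}_T(w)$, or $\mathrm{drift}_T(v)=\mathrm{drift}_T(w)$ and there is $p\le \min(k,\ell)$ with $(s_1,\dots,s_p)=(t_1,\dots,t_p)$ and either $p=k$, or $p<\min(k,\ell)$ and $s_{p+1}>t_{p+1}$. *Marked trees.* A marked $(m,n)$-tree is a pair $(T,\mu)$ where $T$ is an $(m,n)$-tree and $\mu$ is a set of cadet edges of $T$ (the marked edges) such that $j<i$ whenever $\{i,j\}\in\mu$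 and $i$ is the $0$-cadet of $j$. For nodes $i,j$ write $i\sim_\mu j$ if all edges on the path of $T$ between $i$ and $j$ are marked (in particular $i\sim_\mu i$); the equivalence classes are the *blocks*. Let $\overline{\mathcal T}_m^n(\mathcal A)$ be the set of marked $(m,n)$-trees $(T,\mu)$ such that 1. for every block $B$, the graph with vertex set $B$ and with an edge $\{i,j\}$ whenever $\{x_i-x_j=\mathrm{drift}_T(i)-\mathrm{drift}_T(j)\}\in\mathcal A$ is connected; and 2. for every non-marked cadet edge $\{i,j\}$, with $i$ the $s$-cadet of $j$, either $s=0$ and $i<j$, or there are $i'\sim_\mu i$ and $j'\sim_\mu j$ with $\{x_{i'}-x_{j'}=\mathrm{drift}_T(i')-\mathrm{drift}_T(j')\}\in\mathcal A$. For $(T,\mu)\in\overline{\mathcal T}_m^n(\mathcal A)$ let $\overline\Phi_{\mathcal A}(T,\mu)$ be the set of points $x\in\mathbb R^n$ such that - $x_i-x_j=s$ for every marked edge $\{i,j\}$ with $i=s\text{-child}(j)$; - $x_i-x_j<s$ for every $(i,j,s)\in\mathrm{Tr}_m^n(\mathcal A)$ with $i\not\sim_\mu j$ and $i\prec_T s\text{-child}(j)$;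 - $x_i-x_j>s$ for every $(i,j,s)\in\mathrm{Tr}_m^n(\mathcal A)$ with $i\not\sim_\mu j$ and $i\succeq_T s\text{-child}(j)$. A *face* of $\mathcal A$ is a nonempty set of the form $\bigcap_{H\in\mathcal A}\sigma_H\subseteq\mathbb R^n$, where each $\sigma_H$ is $H$ or one of the two open half-spaces bounded by $H$ (the empty intersection being $\mathbb R^n$); its codimension is that of its affine hull. Let $\mathcal F(\mathcal A)$ be the set of faces of $\mathcal A$. **Theorem.** If $\mathcal A\subseteq\mathcal A_m^n$ is strongly transitive, then $\overline\Phi_{\mathcal A}$ is a bijection from $\overline{\mathcal T}_m^n(\mathcal A)$ onto $\mathcal F(\mathcal A)$, and for every $(T,\mu)\in\overline{\mathcal T}_m^n(\mathcal A)$ the number $|\mu|$ of marked edges equals the codimension of the face $\overline\Phi_{\mathcal A}(T,\mu)$. -/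

import Mathlib

namespace Braid

/-- The set `{x ∈ ℝ^n | x i - x j = s}` (a hyperplane when `i ≠ j`). -/
def hyp (n : ℕ) (i j : Fin n) (s : ℝ) : Set (Fin n → ℝ) := {x | x i - x j = s}

/-- The `m`-Catalan arrangement in dimension `n`, as a set of hyperplanes. The indices are
`Fin n = {0, …, n-1}` instead of `{1, …, n}`; only their order matters. -/
def catArr (m n : ℕ) : Set (Set (Fin n → ℝ)) :=
  {H | ∃ i j : Fin n, ∃ s : ℤ, i < j ∧ -(m : ℤ) ≤ s ∧ s ≤ (m : ℤ) ∧ H = hyp n i j (s : ℝ)}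

/-- `(i,j,s) ∈ Tr_m^n`. -/
def TrIdx (m n : ℕ) (i j : Fin n) (s : ℕ) : Prop := s ≤ m ∧ i ≠ j ∧ (0 < s ∨ j < i)

/-- `(i,j,s) ∈ Tr_m^n(A)`. -/
def TrIdxA (m n : ℕ) (A : Set (Set (Fin n → ℝ))) (i j : Fin n) (s : ℕ) : Prop :=
  TrIdx m n i j s ∧ hyp n i j (s : ℝ) ∈ A

/-- A strongly transitive arrangement. -/
def IsStronglyTransitive (n : ℕ) (A : Set (Set (Fin n → ℝ))) : Prop :=
  ∀ i j k : Fin n, i ≠ j → j ≠ k → i ≠ k → ∀ s t : ℕ,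
    hyp n i j (s : ℝ) ∉ A → hyp n j k (t : ℝ) ∉ A → hyp n i k ((s : ℝ) + (t : ℝ)) ∉ A

/-- An `(m,n)`-tree: a rooted `(m+1)`-ary tree with `n` internal nodes labeled bijectively by
`Fin n`. It is given by the root-to-node sequence of child indices (in `{0, …, m}`) of each
node; these sequences are distinct and form a prefix-closed set. Every vertex of the tree is
determined by its sequence, and the leaves are the sequences `path j ++ [s]`, `s ≤ m`, that are
not the sequence of a node. -/
structure LTree (m n : ℕ) where
  path : Fin n → List ℕ
  entry_le : ∀ v : Fin n, ∀ s ∈ path v, s ≤ m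
  inj : Function.Injective path
  parent_closed : ∀ v : Fin n, path v ≠ [] → ∃ w : Fin n, path w = (path v).dropLast

namespace LTree

variable {m n : ℕ}

/-- The drift of a node. -/
def drift (T : LTree m n) (v : Fin n) : ℕ := (T.path v).sum

/-- `i = s`-child`(j)`, for nodes `i` and `j`. -/
def IsChild (T : LTree m n) (i j : Fin n) (s : ℕ) : Prop := T.path i = T.path j ++ [s]

/-- `i = s`-cadet`(j)`: `i` is the `s`-child of `j`, and the `t`-child of `j` is a leaf (it is
not a node) for all `t ∈ {s+1, …, m}`. -/
def IsCadet (T : LTree m n) (i j : Fin n) (s : ℕ) : Prop :=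
  T.IsChild i j s ∧ ∀ t : ℕ, s < t → t ≤ m → ¬ ∃ k, T.IsChild k j t

end LTree

/-- The strict order `v ≺_T w` on the vertices of a tree, in terms of the root-to-vertex
sequences `p` of `v` and `q` of `w`: the vertices are distinct, and either
`drift(v) < drift(w)`, or the drifts are equal and for some `c ≤ length p` the first `c` entries
of `p` and `q` agree and (`c = length p`, or the next entry of `p` is larger than that of
`q`). -/
def vlt (p q : List ℕ) : Prop :=
  p ≠ q ∧ (p.sum < q.sum ∨
    (p.sum = q.sum ∧ ∃ c ≤ p.length, p.take c = q.take c ∧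
      (c = p.length ∨ ∃ (h1 : c < p.length) (h2 : c < q.length), q[c] < p[c])))

/-- `v ≽_T w`, in terms of the root-to-vertex sequences `p` of `v` and `q` of `w`. -/
def vge (p q : List ℕ) : Prop := vlt q p ∨ p = q

/-- `(T,μ)` is a marked tree. An edge of `T` is represented by its lower endpoint (the child),
so that a set of edges is a set of nodes other than the root. Every marked edge is a cadet edge,
and a marked edge between `j` and its `0`-cadet `i` satisfies `j < i`. -/
def IsMarking {m n : ℕ} (T : LTree m n) (μ : Set (Fin n)) : Prop :=
  ∀ i ∈ μ, ∃ j s, T.IsCadet i j s ∧ (s = 0 → j < i)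

/-- The relation `i ∼_μ j`: the nodes `i` and `j` are joined in `T` by a (possibly empty) path
of marked edges. -/
def simMu {m n : ℕ} (T : LTree m n) (μ : Set (Fin n)) : Fin n → Fin n → Prop :=
  Relation.ReflTransGen (fun a b =>
    (a ∈ μ ∧ ∃ s, T.IsChild a b s) ∨ (b ∈ μ ∧ ∃ s, T.IsChild b a s))

/-- The set of blocks of `(T,μ)`. -/
def blocksOf {m n : ℕ} (T : LTree m n) (μ : Set (Fin n)) : Set (Set (Fin n)) :=
  {B | ∃ i, B = {j | simMu T μ i j}}

/-- The block `B` is `A`-connected: any two of its nodes are joined by a path in the graph on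
`B` whose edges are the `{a,b}` with `{x_a - x_b = drift(a) - drift(b)} ∈ A`. -/
def BlockConnected {m n : ℕ} (A : Set (Set (Fin n → ℝ))) (T : LTree m n)
    (B : Set (Fin n)) : Prop :=
  ∀ i ∈ B, ∀ j ∈ B, Relation.ReflTransGen
    (fun a b => a ∈ B ∧ b ∈ B ∧ hyp n a b ((T.drift a : ℝ) - (T.drift b : ℝ)) ∈ A) i j

/-- The marked tree `(T,μ)` is `A`-connected. -/
def AConnected {m n : ℕ} (A : Set (Set (Fin n → ℝ))) (T : LTree m n)
    (μ : Set (Fin n)) : Prop :=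
  ∀ B ∈ blocksOf T μ, BlockConnected A T B

/-- The `A`-cadet condition. -/
def CadetCond {m n : ℕ} (A : Set (Set (Fin n → ℝ))) (T : LTree m n)
    (μ : Set (Fin n)) : Prop :=
  ∀ i j s, T.IsCadet i j s → i ∉ μ →
    ((s = 0 ∧ i < j) ∨
      ∃ i' j', simMu T μ i i' ∧ simMu T μ j j' ∧
        hyp n i' j' ((T.drift i' : ℝ) - (T.drift j' : ℝ)) ∈ A)

/-- The set of marked `(m,n)`-trees which are `A`-connected and satisfy the `A`-cadet
condition. -/
def OTset (m n : ℕ) (A : Set (Set (Fin n → ℝ))) : Set (LTree m n × Set (Fin n)) :=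
  {p | IsMarking p.1 p.2 ∧ AConnected A p.1 p.2 ∧ CadetCond A p.1 p.2}

/-- The polyhedron associated with the marked tree `(T,μ)`. -/
def PhiBar (m n : ℕ) (A : Set (Set (Fin n → ℝ))) (T : LTree m n) (μ : Set (Fin n)) :
    Set (Fin n → ℝ) :=
  {x | (∀ i ∈ μ, ∀ j s, T.IsChild i j s → x i - x j = (s : ℝ)) ∧
       ∀ i j : Fin n, ∀ s : ℕ, TrIdxA m n A i j s → ¬ simMu T μ i j →
         (vlt (T.path i) (T.path j ++ [s]) → x i - x j < (s : ℝ)) ∧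
         (vge (T.path i) (T.path j ++ [s]) → (s : ℝ) < x i - x j)}

/-- `σ` is the hyperplane `H` itself or one of the two open half-spaces bounded by `H`, for a
hyperplane `H` of the form `{x_i - x_j = s}` with `i ≠ j`. -/
def IsSideOf (n : ℕ) (σ H : Set (Fin n → ℝ)) : Prop :=
  σ = H ∨ ∃ (i j : Fin n) (s : ℝ), i ≠ j ∧ H = hyp n i j s ∧
    (σ = {x | x i - x j < s} ∨ σ = {x | s < x i - x j})

/-- `F` is a face of the arrangement `A`. -/
def IsFace (n : ℕ) (A : Set (Set (Fin n → ℝ))) (F : Set (Fin n → ℝ)) : Prop :=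
  F.Nonempty ∧ ∃ σ : Set (Fin n → ℝ) → Set (Fin n → ℝ),
    (∀ H ∈ A, IsSideOf n (σ H) H) ∧ F = ⋂ H ∈ A, σ H

/-- The codimension of (the affine hull of) a nonempty subset of `ℝ^n`. -/
noncomputable def faceCodim (n : ℕ) (F : Set (Fin n → ℝ)) : ℕ :=
  Module.finrank ℝ ((Fin n → ℝ) ⧸ (affineSpan ℝ F).direction)

end Braid

namespace Braid

/-- The depth-first order on sequences of child indices: a prefix comes first, and otherwise the
sequence with the larger entry at the first difference comes first. -/
def dlt : List ℕ → List ℕ → Prop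
  | _, [] => False
  | [], _ :: _ => True
  | a :: p, b :: q => b < a ∨ (a = b ∧ dlt p q)

theorem dlt_nil_right (p : List ℕ) : ¬ dlt p [] := by
  cases p <;> simp [dlt]

theorem dlt_irrefl (p : List ℕ) : ¬ dlt p p := by
  induction p with
  | nil => simp [dlt]
  | cons a p ih => simp [dlt, ih]

theorem dlt_trans {p q r : List ℕ} (h1 : dlt p q) (h2 : dlt q r) : dlt p r := by
  induction p generalizing q r with
  | nil =>
    cases r with
    | nil => exact absurd h2 (dlt_nil_right _)
    | cons c r => simp [dlt]
  | cons a p ih =>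
    cases q with
    | nil => exact absurd h1 (dlt_nil_right _)
    | cons b q =>
      cases r with
      | nil => exact absurd h2 (dlt_nil_right _)
      | cons c r =>
        simp only [dlt] at *
        rcases h1 with h1 | ⟨rfl, h1⟩ <;> rcases h2 with h2 | ⟨rfl, h2⟩
        · left; omega
        · left; omega
        · left; omega
        · exact Or.inr ⟨rfl, ih h1 h2⟩

theorem dlt_trichotomy (p q : List ℕ) : dlt p q ∨ p = q ∨ dlt q p := by
  induction p generalizing q with
  | nil => cases q <;> simp [dlt]
  | cons a p ih =>
    cases q with
    | nil => simp [dlt]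
    | cons b q =>
      rcases lt_trichotomy a b with h | rfl | h
      · exact Or.inr (Or.inr (Or.inl h))
      · rcases ih q with h | rfl | h
        · exact Or.inl (Or.inr ⟨rfl, h⟩)
        · exact Or.inr (Or.inl rfl)
        · exact Or.inr (Or.inr (Or.inr ⟨rfl, h⟩))
      · exact Or.inl (Or.inl h)

theorem dlt_asymm {p q : List ℕ} (h : dlt p q) : ¬ dlt q p :=
  fun h' => dlt_irrefl p (dlt_trans h h')

theorem dlt_append_left (p a b : List ℕ) : dlt (p ++ a) (p ++ b) ↔ dlt a b := by
  induction p with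
  | nil => simp
  | cons c p ih => simp [dlt, ih]

theorem dlt_append_cons (p : List ℕ) (e : ℕ) (w : List ℕ) : dlt p (p ++ e :: w) := by
  have h := (dlt_append_left p [] (e :: w)).2 (by simp [dlt])
  simpa using h

/-- If `p` precedes `q`, then `p` is a proper prefix of `q`, or the comparison is decided at an
entry of both sequences and is stable under appending. -/
theorem dlt_cases {p q : List ℕ} (h : dlt p q) :
    (∃ e w, q = p ++ e :: w) ∨ ∀ w w', dlt (p ++ w) (q ++ w') := by
  induction p generalizing q with
  | nil =>
    cases q with
    | nil => exact absurd h (dlt_nil_right _)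
    | cons b q => exact Or.inl ⟨b, q, rfl⟩
  | cons a p ih =>
    cases q with
    | nil => exact absurd h (dlt_nil_right _)
    | cons b q =>
      rcases h with h | ⟨rfl, h⟩
      · exact Or.inr fun w w' => Or.inl h
      · rcases ih h with ⟨e, w, rfl⟩ | h'
        · exact Or.inl ⟨e, w, rfl⟩
        · exact Or.inr fun w w' => Or.inr ⟨rfl, h' w w'⟩

theorem exists_take_iff_dlt (p q : List ℕ) :
    (p ≠ q ∧ ∃ c ≤ p.length, p.take c = q.take c ∧
      (c = p.length ∨ ∃ (h1 : c < p.length) (h2 : c < q.length), q[c] < p[c])) ↔ dlt p q := by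
  induction p generalizing q with
  | nil =>
    cases q with
    | nil => simp [dlt]
    | cons b q => simp [dlt]
  | cons a p ih =>
    cases q with
    | nil =>
      simp only [dlt, iff_false]
      rintro ⟨-, c, hc, h1, h2⟩
      rcases h2 with rfl | ⟨_, h2, _⟩
      · simp at h1
      · simp at h2
    | cons b q =>
      simp only [dlt, ← ih]
      constructor
      · rintro ⟨hne, c, hc, h1, h2⟩
        cases c with
        | zero =>
          rcases h2 with h2 | ⟨_, _, h2⟩
          · simp at h2
          · left; simpa using h2
        | succ c =>
          simp only [List.take_succ_cons, List.cons.injEq] at h1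
          obtain ⟨rfl, h1⟩ := h1
          refine Or.inr ⟨rfl, by simpa using hne, c, by simpa using hc, h1, ?_⟩
          rcases h2 with h2 | ⟨h3, h4, h2⟩
          · left; simpa using h2
          · exact Or.inr ⟨by simpa using h3, by simpa using h4, by simpa using h2⟩
      · rintro (h | ⟨rfl, hne, c, hc, h1, h2⟩)
        · refine ⟨by simp; omega, 0, by simp, by simp, Or.inr ⟨by simp, by simp, by simpa using h⟩⟩
        · refine ⟨by simpa using hne, c + 1, by simpa using hc, by simpa using h1, ?_⟩
          rcases h2 with h2 | ⟨h3, h4, h2⟩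
          · left; simpa using h2
          · exact Or.inr ⟨by simpa using h3, by simpa using h4, by simpa using h2⟩

theorem vlt_iff (p q : List ℕ) : vlt p q ↔ p.sum < q.sum ∨ (p.sum = q.sum ∧ dlt p q) := by
  unfold vlt
  rw [← exists_take_iff_dlt]
  constructor
  · rintro ⟨h, h1 | ⟨h1, h2⟩⟩
    · exact Or.inl h1
    · exact Or.inr ⟨h1, h, h2⟩
  · rintro (h | ⟨h1, h, h2⟩)
    · exact ⟨fun e => by simp [e] at h, Or.inl h⟩
    · exact ⟨h, Or.inr ⟨h1, h2⟩⟩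

namespace LTree

variable {m n : ℕ} (T : LTree m n)

/-- In the order of the vertices of `T`, the node `i` is above the position of `j` shifted by the
integer `c`; points `x` of the polyhedron of `T` satisfy `x i > x j + c`. -/
def Above (i j : Fin n) (c : ℤ) : Prop :=
  (T.drift j : ℤ) + c < T.drift i ∨
    ((T.drift j : ℤ) + c = T.drift i ∧ dlt (T.path j) (T.path i))

variable {T}

theorem above_self_iff {i : Fin n} {c : ℤ} : T.Above i i c ↔ c < 0 := by
  have := dlt_irrefl (T.path i)
  simp [Above, this]

theorem Above.trans {i j k : Fin n} {c d : ℤ} (h1 : T.Above i j c) (h2 : T.Above j k d) :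
    T.Above i k (c + d) := by
  unfold Above at *
  rcases h1 with h1 | ⟨h1, h1'⟩ <;> rcases h2 with h2 | ⟨h2, h2'⟩
  · left; omega
  · left; omega
  · left; omega
  · exact Or.inr ⟨by omega, dlt_trans h2' h1'⟩

theorem Above.mono {i j : Fin n} {c d : ℤ} (h1 : T.Above i j c) (h : d ≤ c) : T.Above i j d := by
  unfold Above at *
  rcases h.eq_or_lt with rfl | h
  · exact h1
  · left; rcases h1 with h1 | ⟨h1, -⟩ <;> omega

theorem not_above_iff {i j : Fin n} (hij : i ≠ j) {c : ℤ} : ¬ T.Above i j c ↔ T.Above j i (-c) := by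
  have hp : T.path i ≠ T.path j := fun h => hij (T.inj h)
  unfold Above
  rcases dlt_trichotomy (T.path i) (T.path j) with h | h | h
  · have h' := dlt_asymm h
    simp only [h, h', and_true, and_false, or_false]; omega
  · exact absurd h hp
  · have h' := dlt_asymm h
    simp only [h, h', and_true, and_false, or_false]; omega

theorem Above.asymm {i j : Fin n} {c : ℤ} (h : T.Above i j c) : ¬ T.Above j i (-c) := by
  intro h'
  have := h.trans h'
  rw [above_self_iff] at this
  omega

theorem IsChild.drift_eq {i j : Fin n} {s : ℕ} (h : T.IsChild i j s) :
    T.drift i = T.drift j + s := by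
  have : T.path i = T.path j ++ [s] := h
  simp [drift, this]

theorem IsChild.dlt {i j : Fin n} {s : ℕ} (h : T.IsChild i j s) : dlt (T.path j) (T.path i) := by
  have : T.path i = T.path j ++ [s] := h
  rw [this]; exact dlt_append_cons _ _ _

theorem IsChild.above {i j : Fin n} {s : ℕ} (h : T.IsChild i j s) : T.Above i j s :=
  Or.inr ⟨by have := h.drift_eq; omega, h.dlt⟩

theorem IsChild.le {i j : Fin n} {s : ℕ} (h : T.IsChild i j s) : s ≤ m := by
  have : T.path i = T.path j ++ [s] := h
  exact T.entry_le i s (by simp [this])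

theorem IsChild.ne {i j : Fin n} {s : ℕ} (h : T.IsChild i j s) : i ≠ j := by
  rintro rfl
  have : T.path i = T.path i ++ [s] := h
  simp at this

theorem IsChild.parent_unique {i j j' : Fin n} {s s' : ℕ} (h : T.IsChild i j s)
    (h' : T.IsChild i j' s') : j = j' ∧ s = s' := by
  have h1 : T.path i = T.path j ++ [s] := h
  have h2 : T.path i = T.path j' ++ [s'] := h'
  rw [h1] at h2
  have := List.append_inj' h2 rfl
  exact ⟨T.inj this.1, by simpa using this.2⟩

theorem IsChild.child_unique {i i' j : Fin n} {s : ℕ} (h : T.IsChild i j s)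
    (h' : T.IsChild i' j s) : i = i' :=
  T.inj (Eq.trans (show T.path i = T.path j ++ [s] from h) (Eq.symm h'))

theorem IsCadet.unique {i i' j : Fin n} {s s' : ℕ} (h : T.IsCadet i j s) (h' : T.IsCadet i' j s') :
    i = i' ∧ s = s' := by
  rcases lt_trichotomy s s' with hs | rfl | hs
  · exact absurd ⟨i', h'.1⟩ (h.2 s' hs h'.1.le)
  · exact ⟨h.1.child_unique h'.1, rfl⟩
  · exact absurd ⟨i, h.1⟩ (h'.2 s hs h.1.le)

theorem exists_parent {i : Fin n} (h : T.path i ≠ []) : ∃ j s, T.IsChild i j s := by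
  obtain ⟨j, hj⟩ := T.parent_closed i h
  refine ⟨j, (T.path i).getLast h, ?_⟩
  unfold IsChild
  rw [hj, List.dropLast_append_getLast]

/-- A node which is above some other node by a nonnegative amount is not the root. -/
theorem Above.exists_parent {i k : Fin n} {u : ℤ} (h : T.Above i k u) (hu : 0 ≤ u) :
    ∃ j s, T.IsChild i j s := by
  apply LTree.exists_parent
  intro h0
  have hd : T.drift i = 0 := by simp [drift, h0]
  rcases h with h | ⟨-, h⟩
  · omega
  · rw [h0] at h; exact dlt_nil_right _ h

/-- The position of `j` shifted by `s` immediately precedes the `s`-child of `j`. -/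
theorem IsChild.pred {i j k : Fin n} {s : ℕ} {u : ℤ} (h : T.IsChild i j s) (hu : 0 ≤ u)
    (hk : T.Above i k u) : (k = j ∧ u = s) ∨ T.Above j k (u - s) := by
  have hd := h.drift_eq
  rcases hk with hk | ⟨hk, hl⟩
  · right; left; omega
  · have hp : T.path i = T.path j ++ [s] := h
    rcases dlt_trichotomy (T.path k) (T.path j) with h1 | h1 | h1
    · exact Or.inr (Or.inr ⟨by omega, h1⟩)
    · left
      have := T.inj h1
      subst this
      exact ⟨rfl, by omega⟩
    · exfalso
      rcases dlt_cases h1 with ⟨e, w, he⟩ | h2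
      · rw [hp, he, dlt_append_left] at hl
        have hdk : T.drift k = T.drift j + (e + w.sum) := by simp [drift, he]
        rcases hl with hl | ⟨rfl, hl⟩
        · omega
        · exact dlt_nil_right _ hl
      · have := h2 [s] []
        rw [← hp, List.append_nil] at this
        exact dlt_asymm this hl

/-- Comparison of a node with a vertex, in terms of the comparison of two nodes. -/
theorem vge_iff_above {i j : Fin n} (hij : i ≠ j) (s : ℕ) :
    vge (T.path i) (T.path j ++ [s]) ↔ T.Above i j s := by
  have hp : T.path i ≠ T.path j := fun h => hij (T.inj h)
  have key : (T.path j ++ [s]).sum = (T.path i).sum →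
      ((dlt (T.path j ++ [s]) (T.path i) ∨ T.path i = T.path j ++ [s]) ↔
        dlt (T.path j) (T.path i)) := by
    intro hs
    constructor
    · rintro (h | h)
      · exact dlt_trans (dlt_append_cons _ _ _) h
      · rw [h]; exact dlt_append_cons _ _ _
    · intro h
      rcases dlt_cases h with ⟨e, w, he⟩ | h'
      · rw [he] at hs ⊢
        rw [dlt_append_left]
        simp only [List.sum_append, List.sum_cons, List.sum_nil] at hs
        rcases Nat.lt_or_ge e s with h1 | h1
        · exact Or.inl (Or.inl h1)
        · have : e = s := by omega
          subst this
          cases w with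
          | nil => right; rfl
          | cons f w => left; exact Or.inr ⟨rfl, trivial⟩
      · left; simpa using h' [s] []
  have hsum : (T.path j ++ [s]).sum = T.drift j + s := by simp [drift]
  have hsum' : (T.path i).sum = T.drift i := rfl
  unfold vge Above
  rw [vlt_iff]
  constructor
  · rintro ((h | ⟨h, h'⟩) | h)
    · left; omega
    · exact Or.inr ⟨by omega, (key h).1 (Or.inl h')⟩
    · have h2 : (T.path j ++ [s]).sum = (T.path i).sum := by rw [h]
      exact Or.inr ⟨by omega, (key h2).1 (Or.inr h)⟩
  · rintro (h | ⟨h, h'⟩)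
    · left; left; omega
    · have h2 : (T.path j ++ [s]).sum = (T.path i).sum := by omega
      rcases (key h2).2 h' with h3 | h3
      · exact Or.inl (Or.inr ⟨h2, h3⟩)
      · exact Or.inr h3

theorem vlt_iff_not_vge (p q : List ℕ) : vlt p q ↔ ¬ vge p q := by
  unfold vge
  rw [vlt_iff, vlt_iff]
  rcases dlt_trichotomy p q with h | rfl | h
  · have h' := dlt_asymm h
    have hne : p ≠ q := by rintro rfl; exact dlt_irrefl _ h
    simp only [h, h', hne]; simp; omega
  · simp [dlt_irrefl]
  · have h' := dlt_asymm h
    have hne : p ≠ q := by rintro rfl; exact dlt_irrefl _ h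
    simp only [h, h', hne]; simp; omega

theorem vlt_iff_not_above {i j : Fin n} (hij : i ≠ j) (s : ℕ) :
    vlt (T.path i) (T.path j ++ [s]) ↔ ¬ T.Above i j s := by
  rw [vlt_iff_not_vge, vge_iff_above hij]

/-- A tree is determined by the order of its vertices. -/
theorem eq_of_above_iff {T T' : LTree m n} (h : ∀ i j : Fin n, ∀ c : ℤ, i ≠ j → 0 ≤ c →
    (T.Above i j c ↔ T'.Above i j c)) : T = T' := by
  have hall : ∀ i j : Fin n, ∀ c : ℤ, T.Above i j c ↔ T'.Above i j c := by
    intro i j c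
    by_cases hij : i = j
    · subst hij; rw [above_self_iff, above_self_iff]
    rcases le_or_gt 0 c with hc | hc
    · exact h i j c hij hc
    · rw [← not_iff_not, not_above_iff hij, not_above_iff hij]
      exact h j i (-c) (Ne.symm hij) (by omega)
  have hpath : ∀ N : ℕ, ∀ i, (T.path i).length = N → T.path i = T'.path i := by
    intro N
    induction N with
    | zero =>
      intro i hi
      rw [List.length_eq_zero_iff] at hi
      by_contra hne
      obtain ⟨j, s, hj⟩ := LTree.exists_parent (T := T') (i := i)
        (fun h0 => hne (hi.trans h0.symm))
      have h1 := (hall i j s).2 hj.above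
      obtain ⟨k, u, hk⟩ := h1.exists_parent (by omega)
      have : T.path i = T.path k ++ [u] := hk
      simp [hi] at this
    | succ N ih =>
      intro i hi
      obtain ⟨j, s, hj⟩ := LTree.exists_parent (T := T) (i := i)
        (fun h0 => by simp [h0] at hi)
      have hjp : T.path i = T.path j ++ [s] := hj
      have h1 := (hall i j s).1 hj.above
      obtain ⟨k, u, hk⟩ := h1.exists_parent (by omega)
      have hkp : T'.path i = T'.path k ++ [u] := hk
      have h2 := hk.pred (by omega) h1
      have h3 := hj.pred (by omega) ((hall i k u).2 hk.above)
      have h4 : j = k ∧ s = u := by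
        rcases h2 with ⟨a, b⟩ | h2
        · exact ⟨a, by omega⟩
        · rcases h3 with ⟨a, b⟩ | h3
          · exact ⟨a.symm, by omega⟩
          · exfalso
            rw [← hall] at h2
            apply h2.asymm
            convert h3 using 1; ring
      obtain ⟨rfl, rfl⟩ := h4
      rw [hjp, hkp, ih j]
      simp [hjp] at hi
      exact hi
  have : T.path = T'.path := funext fun i => hpath _ i rfl
  cases T; cases T'
  simpa using this

end LTree

end Braid

namespace Braid

namespace LTree

variable {m n : ℕ} {T : LTree m n}

theorem exists_node_of_prefix (p w : List ℕ) (k : Fin n) (h : T.path k = p ++ w) :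
    ∃ j, T.path j = p := by
  induction w using List.reverseRecOn generalizing k with
  | nil => exact ⟨k, by simpa using h⟩
  | append_singleton w a ih =>
    obtain ⟨j, hj⟩ := T.parent_closed k (by simp [h])
    refine ih j ?_
    rw [hj, h, ← List.append_assoc, List.dropLast_concat]

/-- A cadet immediately follows its parent in depth-first order. -/
theorem IsCadet.not_dlt {i j k : Fin n} {s : ℕ} (h : T.IsCadet i j s)
    (hk : dlt (T.path j) (T.path k)) : ¬ dlt (T.path k) (T.path i) := by
  have hi : T.path i = T.path j ++ [s] := h.1
  rcases dlt_cases hk with ⟨e, w, he⟩ | h'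
  · obtain ⟨l, hl⟩ := exists_node_of_prefix (T := T) (T.path j ++ [e]) w k (by simp [he])
    have hlc : T.IsChild l j e := hl
    have hes : e ≤ s := by
      by_contra hlt
      exact h.2 e (by omega) hlc.le ⟨l, hlc⟩
    rw [hi, he, dlt_append_left]
    rintro (h1 | ⟨-, h1⟩)
    · omega
    · exact dlt_nil_right _ h1
  · have := h' [s] []
    rw [← hi, List.append_nil] at this
    exact dlt_asymm this

/-- A node with an `s`-child has a cadet, at or to the right of position `s`. -/
theorem IsChild.exists_cadet {i j : Fin n} {s : ℕ} (h : T.IsChild i j s) :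
    ∃ k t, T.IsCadet k j t ∧ s ≤ t := by
  classical
  have hne : ∃ t, (∃ k, T.IsChild k j t) ∧ s ≤ t := ⟨s, ⟨i, h⟩, le_rfl⟩
  have hb : ∀ t, ((∃ k, T.IsChild k j t) ∧ s ≤ t) → t ≤ m := fun t ht => ht.1.choose_spec.le
  have hspec := Nat.findGreatest_spec (P := fun t => (∃ k, T.IsChild k j t) ∧ s ≤ t)
    (hb s ⟨⟨i, h⟩, le_rfl⟩) ⟨⟨i, h⟩, le_rfl⟩
  obtain ⟨⟨k, hk⟩, hs⟩ := hspec
  refine ⟨k, _, ⟨hk, fun t ht htm hex => ?_⟩, hs⟩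
  exact Nat.findGreatest_is_greatest ht htm ⟨hex, by omega⟩

end LTree

variable {m n : ℕ} {T : LTree m n} {μ : Set (Fin n)}

/-- `j` is reached from `i` by going down along marked edges. -/
def MarkedBelow (T : LTree m n) (μ : Set (Fin n)) : Fin n → Fin n → Prop :=
  Relation.ReflTransGen (fun a b => b ∈ μ ∧ ∃ s, T.IsChild b a s)

theorem IsMarking.isCadet (hμ : IsMarking T μ) {i j : Fin n} {s : ℕ} (hi : i ∈ μ)
    (h : T.IsChild i j s) : T.IsCadet i j s ∧ (s = 0 → j < i) := by
  obtain ⟨j', s', h1, h2⟩ := hμ i hi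
  obtain ⟨rfl, rfl⟩ := h.parent_unique h1.1
  exact ⟨h1, h2⟩

theorem simMu_symm {i j : Fin n} (h : simMu T μ i j) : simMu T μ j i := by
  induction h with
  | refl => exact .refl
  | tail _ hbc ih => exact .head hbc.symm ih

theorem simMu_trans {i j k : Fin n} (h : simMu T μ i j) (h' : simMu T μ j k) : simMu T μ i k :=
  Relation.ReflTransGen.trans h h'

theorem simMu_refl (i : Fin n) : simMu T μ i i := Relation.ReflTransGen.refl

theorem simMu_of_mem {i j : Fin n} {s : ℕ} (hi : i ∈ μ) (h : T.IsChild i j s) : simMu T μ i j :=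
  Relation.ReflTransGen.single (Or.inl ⟨hi, s, h⟩)

theorem MarkedBelow.simMu {i j : Fin n} (h : MarkedBelow T μ i j) : simMu T μ i j :=
  Relation.ReflTransGen.mono (fun _ _ hab => Or.inr hab) _ _ h

theorem simMu.markedBelow (hμ : IsMarking T μ) {i j : Fin n} (h : simMu T μ i j) :
    MarkedBelow T μ i j ∨ MarkedBelow T μ j i := by
  induction h with
  | refl => exact Or.inl .refl
  | @tail b c _ hbc ih =>
    rcases hbc with ⟨hb, s, hs⟩ | ⟨hc, s, hs⟩
    · rcases ih with ih | ih
      · rcases Relation.ReflTransGen.cases_tail ih with rfl | ⟨d, hd, -, s', hs'⟩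
        · exact Or.inr (.single ⟨hb, s, hs⟩)
        · obtain ⟨rfl, -⟩ := hs.parent_unique hs'
          exact Or.inl hd
      · exact Or.inr (.head ⟨hb, s, hs⟩ ih)
    · rcases ih with ih | ih
      · exact Or.inl (ih.tail ⟨hc, s, hs⟩)
      · rcases Relation.ReflTransGen.cases_head ih with rfl | ⟨d, ⟨hd, s', hs'⟩, hdi⟩
        · exact Or.inl (.single ⟨hc, s, hs⟩)
        · obtain ⟨rfl, -⟩ := (hμ.isCadet hc hs).1.unique (hμ.isCadet hd hs').1
          exact Or.inr hdi

theorem MarkedBelow.drift_le {i j : Fin n} (h : MarkedBelow T μ i j) : T.drift i ≤ T.drift j := by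
  induction h with
  | refl => exact le_rfl
  | tail _ hbc ih =>
    obtain ⟨-, s, hs⟩ := hbc
    have := hs.drift_eq
    omega

theorem MarkedBelow.le (hμ : IsMarking T μ) {i j : Fin n} (h : MarkedBelow T μ i j)
    (hd : T.drift i = T.drift j) : i ≤ j := by
  induction h with
  | refl => exact le_rfl
  | @tail b c hb hbc ih =>
    obtain ⟨hc, s, hs⟩ := hbc
    have h1 := hs.drift_eq
    have h2 := MarkedBelow.drift_le hb
    exact (ih (by omega)).trans ((hμ.isCadet hc hs).2 (by omega)).le

theorem MarkedBelow.eq_or_dlt {i j : Fin n} (h : MarkedBelow T μ i j) :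
    i = j ∨ dlt (T.path i) (T.path j) := by
  induction h with
  | refl => exact Or.inl rfl
  | tail _ hbc ih =>
    obtain ⟨hc, s, hs⟩ := hbc
    rcases ih with rfl | ih
    · exact Or.inr hs.dlt
    · exact Or.inr (dlt_trans ih hs.dlt)

/-- A node whose edge to its parent is not marked is the top of its block. -/
theorem simMu.markedBelow_of_notMem (hμ : IsMarking T μ) {i j : Fin n} (h : simMu T μ i j)
    (hi : i ∉ μ) : MarkedBelow T μ i j := by
  rcases h.markedBelow hμ with h | h
  · exact h
  · rcases Relation.ReflTransGen.cases_tail h with rfl | ⟨d, -, hm, -⟩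
    · exact .refl
    · exact absurd hm hi

/-- A node whose edge to its cadet is not marked is the bottom of its block. -/
theorem simMu.markedBelow_of_cadet_notMem (hμ : IsMarking T μ) {i j k : Fin n} {s : ℕ}
    (h : simMu T μ j k) (hi : T.IsCadet i j s) (him : i ∉ μ) : MarkedBelow T μ k j := by
  rcases h.markedBelow hμ with h | h
  · rcases Relation.ReflTransGen.cases_head h with rfl | ⟨d, ⟨hd, s', hs'⟩, -⟩
    · exact .refl
    · obtain ⟨rfl, -⟩ := hi.unique (hμ.isCadet hd hs').1
      exact absurd hd him
  · exact h

theorem dlt_iff_lt_of_simMu (hμ : IsMarking T μ) {i j : Fin n} (h : simMu T μ i j)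
    (hd : T.drift i = T.drift j) : dlt (T.path i) (T.path j) ↔ i < j := by
  rcases h.markedBelow hμ with h | h
  · rcases h.eq_or_dlt with rfl | h1
    · simp [dlt_irrefl]
    · have hne : i ≠ j := by rintro rfl; exact dlt_irrefl _ h1
      simp only [h1, true_iff]
      exact lt_of_le_of_ne (h.le hμ hd) hne
  · rcases h.eq_or_dlt with rfl | h1
    · simp [dlt_irrefl]
    · simp only [dlt_asymm h1, false_iff, not_lt]
      exact h.le hμ hd.symm

theorem sub_eq_of_simMu {x : Fin n → ℝ}
    (hx : ∀ i ∈ μ, ∀ j s, T.IsChild i j s → x i - x j = (s : ℝ)) {i j : Fin n}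
    (h : simMu T μ i j) : x i - x j = (T.drift i : ℝ) - T.drift j := by
  induction h with
  | refl => simp
  | tail _ hbc ih =>
    rcases hbc with ⟨hb, s, hs⟩ | ⟨hc, s, hs⟩
    · have h1 := hx _ hb _ s hs
      have h2 : (T.drift _ : ℝ) = _ := congrArg Nat.cast hs.drift_eq
      push_cast at h2
      linarith
    · have h1 := hx _ hc _ s hs
      have h2 : (T.drift _ : ℝ) = _ := congrArg Nat.cast hs.drift_eq
      push_cast at h2
      linarith

theorem exists_top (T : LTree m n) (μ : Set (Fin n)) (hμ : IsMarking T μ) (i : Fin n) :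
    ∃ t, t ∉ μ ∧ MarkedBelow T μ t i := by
  generalize hN : (T.path i).length = N
  induction N using Nat.strong_induction_on generalizing i with
  | _ N ih =>
    by_cases hi : i ∈ μ
    · obtain ⟨j, s, hj, -⟩ := hμ i hi
      have hp : T.path i = T.path j ++ [s] := hj.1
      obtain ⟨t, ht, htj⟩ := ih (T.path j).length (by simp [hp] at hN; omega) j rfl
      exact ⟨t, ht, htj.tail ⟨hi, s, hj.1⟩⟩
    · exact ⟨i, hi, .refl⟩

open Classical in
/-- The rank, in depth-first order, of the block containing `i`: the number of blocks whose top
comes weakly before `i`. -/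
noncomputable def blockRank (T : LTree m n) (μ : Set (Fin n)) (i : Fin n) : ℕ :=
  (Finset.univ.filter fun k => k ∉ μ ∧ ¬ dlt (T.path i) (T.path k)).card

theorem blockRank_le (T : LTree m n) (μ : Set (Fin n)) (i : Fin n) : blockRank T μ i ≤ n := by
  classical
  exact (Finset.card_filter_le _ _).trans (by simp)

theorem blockRank_mono {i j : Fin n} (h : dlt (T.path i) (T.path j)) :
    blockRank T μ i ≤ blockRank T μ j := by
  apply Finset.card_le_card
  intro k
  simp only [Finset.mem_filter, Finset.mem_univ, true_and]
  exact fun ⟨h1, h2⟩ => ⟨h1, fun h3 => h2 (dlt_trans h h3)⟩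

theorem blockRank_lt {i j : Fin n} (h : dlt (T.path i) (T.path j)) (hj : j ∉ μ) :
    blockRank T μ i < blockRank T μ j := by
  apply Finset.card_lt_card
  rw [Finset.ssubset_iff_of_subset]
  · exact ⟨j, by simp [hj, dlt_irrefl], by simp [h]⟩
  · intro k
    simp only [Finset.mem_filter, Finset.mem_univ, true_and]
    exact fun ⟨h1, h2⟩ => ⟨h1, fun h3 => h2 (dlt_trans h h3)⟩

theorem not_dlt_cadet_iff {i j : Fin n} {s : ℕ} (h : T.IsCadet i j s) (k : Fin n) :
    ¬ dlt (T.path i) (T.path k) ↔ k = i ∨ ¬ dlt (T.path j) (T.path k) := by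
  constructor
  · intro h1
    rcases dlt_trichotomy (T.path i) (T.path k) with h2 | h2 | h2
    · exact absurd h2 h1
    · exact Or.inl (T.inj h2.symm)
    · right
      intro h3
      exact h.not_dlt h3 h2
  · rintro (rfl | h1)
    · exact dlt_irrefl _
    · exact fun h2 => h1 (dlt_trans h.1.dlt h2)

theorem blockRank_cadet_of_mem {i j : Fin n} {s : ℕ} (h : T.IsCadet i j s) (hi : i ∈ μ) :
    blockRank T μ i = blockRank T μ j := by
  unfold blockRank
  congr 1
  ext k
  simp only [Finset.mem_filter, Finset.mem_univ, true_and, not_dlt_cadet_iff h]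
  constructor
  · rintro ⟨h1, rfl | h2⟩
    · exact absurd hi h1
    · exact ⟨h1, h2⟩
  · exact fun ⟨h1, h2⟩ => ⟨h1, Or.inr h2⟩

theorem blockRank_cadet_of_notMem {i j : Fin n} {s : ℕ} (h : T.IsCadet i j s) (hi : i ∉ μ) :
    blockRank T μ i = blockRank T μ j + 1 := by
  classical
  unfold blockRank
  rw [← Finset.card_insert_of_notMem (a := i) (by simp [h.1.dlt])]
  congr 1
  ext k
  simp only [Finset.mem_filter, Finset.mem_univ, true_and, not_dlt_cadet_iff h,
    Finset.mem_insert]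
  constructor
  · rintro ⟨h1, rfl | h2⟩
    · exact Or.inl rfl
    · exact Or.inr ⟨h1, h2⟩
  · rintro (rfl | ⟨h1, h2⟩)
    · exact ⟨hi, Or.inl rfl⟩
    · exact ⟨h1, Or.inr h2⟩

theorem blockRank_eq_iff (hμ : IsMarking T μ) {i j : Fin n} :
    blockRank T μ i = blockRank T μ j ↔ simMu T μ i j := by
  have h1 : ∀ {a b}, simMu T μ a b → blockRank T μ a = blockRank T μ b := by
    intro a b hab
    induction hab with
    | refl => rfl
    | tail _ hbc ih =>
      rcases hbc with ⟨hb, s, hs⟩ | ⟨hc, s, hs⟩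
      · rw [ih, blockRank_cadet_of_mem (hμ.isCadet hb hs).1 hb]
      · rw [ih, blockRank_cadet_of_mem (hμ.isCadet hc hs).1 hc]
  refine ⟨fun h => ?_, h1⟩
  obtain ⟨t, ht, hti⟩ := exists_top T μ hμ i
  obtain ⟨t', ht', htj⟩ := exists_top T μ hμ j
  have e1 := h1 hti.simMu
  have e2 := h1 htj.simMu
  rcases dlt_trichotomy (T.path t) (T.path t') with h2 | h2 | h2
  · have := blockRank_lt h2 ht'; omega
  · obtain rfl := T.inj h2
    exact simMu_trans (simMu_symm hti.simMu) htj.simMu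
  · have := blockRank_lt h2 ht; omega

theorem dlt_iff_blockRank_lt (hμ : IsMarking T μ) {i j : Fin n} (h : ¬ simMu T μ i j) :
    dlt (T.path j) (T.path i) ↔ blockRank T μ j < blockRank T μ i := by
  rw [← blockRank_eq_iff hμ] at h
  rcases dlt_trichotomy (T.path j) (T.path i) with h1 | h1 | h1
  · have := blockRank_mono (μ := μ) h1
    simp only [h1, true_iff]; omega
  · obtain rfl := T.inj h1
    exact absurd rfl h
  · have := blockRank_mono (μ := μ) h1
    simp only [dlt_asymm h1, false_iff]; omega

theorem above_iff_blockRank (hμ : IsMarking T μ) {i j : Fin n} (h : ¬ simMu T μ i j) (c : ℤ) :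
    T.Above i j c ↔ (T.drift j : ℤ) + c < T.drift i ∨
      ((T.drift j : ℤ) + c = T.drift i ∧ blockRank T μ j < blockRank T μ i) := by
  unfold LTree.Above
  rw [dlt_iff_blockRank_lt hμ h]

/-- The order of the positions of nodes in different blocks depends only on the blocks. -/
theorem above_congr (hμ : IsMarking T μ) {i j i' j' : Fin n} (h : ¬ simMu T μ i j)
    (hi : simMu T μ i i') (hj : simMu T μ j j') (c : ℤ) :
    T.Above i j c ↔
      T.Above i' j' (c + ((T.drift i' : ℤ) - T.drift i) - ((T.drift j' : ℤ) - T.drift j)) := by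
  have h' : ¬ simMu T μ i' j' := fun h1 =>
    h (simMu_trans hi (simMu_trans h1 (simMu_symm hj)))
  rw [above_iff_blockRank hμ h, above_iff_blockRank hμ h']
  rw [← blockRank_eq_iff hμ] at hi hj
  rw [hi, hj]
  constructor
  · rintro (h | ⟨h, h1⟩)
    · left; omega
    · exact Or.inr ⟨by omega, h1⟩
  · rintro (h | ⟨h, h1⟩)
    · left; omega
    · exact Or.inr ⟨by omega, h1⟩

/-- A numerical form of the order of the positions. -/
noncomputable def LTree.height (T : LTree m n) (i : Fin n) : ℕ :=
  n * T.drift i + blockRank T ∅ i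

theorem LTree.above_iff_height {i j : Fin n} {c : ℤ} :
    T.Above i j c ↔ (T.height j : ℤ) + n * c < T.height i := by
  have hpos : ∀ k, 0 < blockRank T ∅ k := fun k =>
    Finset.card_pos.2 ⟨k, by simp [dlt_irrefl]⟩
  have h1 := hpos i
  have h2 := hpos j
  have h3 := blockRank_le T ∅ i
  have h4 := blockRank_le T ∅ j
  have hlt : dlt (T.path j) (T.path i) ↔ blockRank T ∅ j < blockRank T ∅ i := by
    rcases dlt_trichotomy (T.path j) (T.path i) with h | h | h
    · simp only [h, true_iff]; exact blockRank_lt h (by simp)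
    · rw [T.inj h]; simp [dlt_irrefl]
    · have := blockRank_lt (μ := ∅) h (by simp)
      simp only [dlt_asymm h, false_iff]; omega
  unfold Above height
  rw [hlt]
  generalize blockRank T ∅ i = a at *
  generalize blockRank T ∅ j = b at *
  push_cast
  rcases lt_trichotomy ((T.drift j : ℤ) + c) (T.drift i) with h | h | h
  · simp only [h, true_or, true_iff]
    have : (n : ℤ) * ((T.drift j : ℤ) + c + 1) ≤ n * T.drift i := by
      apply mul_le_mul_of_nonneg_left _ (by omega); omega
    linarith
  · rw [← h]
    simp only [lt_self_iff_false, false_or, true_and]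
    constructor
    · intro h5; have : (b : ℤ) < a := by omega
      linarith
    · intro h5; have : (b : ℤ) < a := by linarith
      omega
  · have h6 : ¬ ((T.drift j : ℤ) + c = T.drift i) := by omega
    simp only [not_lt.2 h.le, h6, false_and, or_self, false_iff, not_lt]
    have : (n : ℤ) * (T.drift i + 1) ≤ n * ((T.drift j : ℤ) + c) := by
      apply mul_le_mul_of_nonneg_left _ (by omega); omega
    linarith

/-- The point with integral parts `d` and fractional parts proportional to `r`. -/
noncomputable def ptOf (d r : Fin n → ℕ) (i : Fin n) : ℝ := d i + r i / (n + 1)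

theorem abs_frac_sub_lt_one {r : Fin n → ℕ} (hr : ∀ i, r i ≤ n) (i j : Fin n) :
    |(r i : ℝ) / (n + 1) - r j / (n + 1)| < 1 := by
  have hpos : (0 : ℝ) < n + 1 := by positivity
  rw [← sub_div, abs_div, abs_of_pos hpos, div_lt_one hpos, abs_lt]
  have h1 : (r i : ℝ) ≤ n := by exact_mod_cast hr i
  have h2 : (r j : ℝ) ≤ n := by exact_mod_cast hr j
  have h3 : (0 : ℝ) ≤ r i := by positivity
  have h4 : (0 : ℝ) ≤ r j := by positivity
  constructor <;> linarith

theorem ptOf_lt_iff {d r : Fin n → ℕ} (hr : ∀ i, r i ≤ n) (i j : Fin n) (c : ℤ) :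
    (c : ℝ) < ptOf d r i - ptOf d r j ↔
      (d j : ℤ) + c < d i ∨ ((d j : ℤ) + c = d i ∧ r j < r i) := by
  have h := abs_lt.1 (abs_frac_sub_lt_one hr i j)
  have hpos : (0 : ℝ) < n + 1 := by positivity
  unfold ptOf
  rcases lt_trichotomy ((d j : ℤ) + c) (d i) with h1 | h1 | h1
  · simp only [h1, true_or, iff_true]
    have : ((d j : ℤ) : ℝ) + c + 1 ≤ (d i : ℤ) := by exact_mod_cast h1
    push_cast at this
    linarith [h.1]
  · simp only [h1, lt_self_iff_false, false_or, true_and]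
    have : ((d j : ℤ) : ℝ) + c = (d i : ℤ) := by exact_mod_cast h1
    push_cast at this
    rw [← Nat.cast_lt (α := ℝ), ← div_lt_div_iff_of_pos_right (a := (r j : ℝ)) hpos]
    constructor <;> intro h2 <;> linarith
  · have h6 : ¬ ((d j : ℤ) + c = d i) := by omega
    simp only [not_lt.2 h1.le, h6, false_and, or_self, iff_false, not_lt]
    have : ((d i : ℤ) : ℝ) + 1 ≤ (d j : ℤ) + c := by exact_mod_cast h1
    push_cast at this
    linarith [h.2]

theorem ptOf_eq_iff {d r : Fin n → ℕ} (hr : ∀ i, r i ≤ n) (i j : Fin n) (c : ℤ) :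
    ptOf d r i - ptOf d r j = c ↔ (d j : ℤ) + c = d i ∧ r j = r i := by
  have h1 := ptOf_lt_iff (d := d) hr i j c
  have h2 := ptOf_lt_iff (d := d) hr j i (-c)
  push_cast at h2
  have h3 : ptOf d r i - ptOf d r j = c ↔ ¬ ((c : ℝ) < ptOf d r i - ptOf d r j) ∧
      ¬ (-(c : ℝ) < ptOf d r j - ptOf d r i) := by
    constructor
    · intro h; constructor <;> linarith
    · rintro ⟨h, h'⟩; linarith
  rw [h3, h1, h2]
  omega

end Braid

namespace Braid

variable {m n : ℕ} {A : Set (Set (Fin n → ℝ))}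

theorem hyp_symm (i j : Fin n) (c : ℝ) : hyp n i j c = hyp n j i (-c) := by
  ext x
  simp only [hyp, Set.mem_ofPred_eq]
  constructor <;> intro h <;> linarith

theorem hyp_eq_hyp {i j i' j' : Fin n} {c c' : ℝ} (hne : i' ≠ j')
    (h : hyp n i j c = hyp n i' j' c') :
    (i = i' ∧ j = j' ∧ c = c') ∨ (i = j' ∧ j = i' ∧ c = -c') := by
  have key : ∀ x : Fin n → ℝ, x i - x j = c ↔ x i' - x j' = c' := fun x =>
    Set.ext_iff.1 h x
  have h0 := (key (Pi.single i' c')).2 (by simp [hne.symm])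
  have hij : i ≠ j := by
    rintro rfl
    have h1 := (key (Pi.single i' (c' + 1))).1 (by simpa using h0)
    simp [hne.symm] at h1
  have hmem : ∀ k, k ≠ i' → k ≠ j' → k ≠ i ∧ k ≠ j := by
    intro k hk hk'
    have h1 := (key (Pi.single i' c' + Pi.single k 1)).2 (by simp [hne.symm, hk.symm, hk'.symm])
    simp only [Pi.add_apply] at h1
    have h2 : (Pi.single k 1 : Fin n → ℝ) i - (Pi.single k 1 : Fin n → ℝ) j = 0 := by linarith
    constructor
    · rintro rfl; simp [hij.symm] at h2
    · rintro rfl; simp [hij] at h2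
  have hi : i = i' ∨ i = j' := by
    by_contra hcon
    push Not at hcon
    exact (hmem i hcon.1 hcon.2).1 rfl
  have hj : j = i' ∨ j = j' := by
    by_contra hcon
    push Not at hcon
    exact (hmem j hcon.1 hcon.2).2 rfl
  rcases hi with rfl | rfl <;> rcases hj with rfl | rfl
  · exact absurd rfl hij
  · left; simpa [hij.symm] using h0.symm
  · right; simpa [hij] using h0.symm
  · exact absurd rfl hij

theorem of_hyp_mem (hA : A ⊆ catArr m n) {i j : Fin n} {c : ℝ} (h : hyp n i j c ∈ A) :
    i ≠ j ∧ ∃ s : ℤ, c = s ∧ -(m : ℤ) ≤ s ∧ s ≤ m := by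
  obtain ⟨a, b, s, hab, h1, h2, he⟩ := hA h
  rcases hyp_eq_hyp hab.ne he with ⟨rfl, rfl, rfl⟩ | ⟨rfl, rfl, rfl⟩
  · exact ⟨hab.ne, s, rfl, h1, h2⟩
  · exact ⟨hab.ne', -s, by simp, by omega, by omega⟩

/-- The hyperplane `{x i - x j = c}`, for an integer `c`, belongs to `A`. -/
def InArr (A : Set (Set (Fin n → ℝ))) (i j : Fin n) (c : ℤ) : Prop := hyp n i j (c : ℝ) ∈ A

theorem InArr.symm {i j : Fin n} {c d : ℤ} (h : InArr A i j c) (hd : d = -c) : InArr A j i d := by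
  unfold InArr at *
  rw [hyp_symm, hd]
  simpa using h

theorem InArr.ne (hA : A ⊆ catArr m n) {i j : Fin n} {c : ℤ} (h : InArr A i j c) : i ≠ j :=
  (of_hyp_mem hA h).1

theorem InArr.bound (hA : A ⊆ catArr m n) {i j : Fin n} {c : ℤ} (h : InArr A i j c) :
    -(m : ℤ) ≤ c ∧ c ≤ m := by
  obtain ⟨s, hs, h1⟩ := (of_hyp_mem hA h).2
  have : c = s := by exact_mod_cast hs
  rwa [this]

theorem InArr.split (hst : IsStronglyTransitive n A) (hA : A ⊆ catArr m n) {i k : Fin n}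
    {e : ℤ} (h : InArr A i k e) (j : Fin n) (hij : i ≠ j) (hjk : j ≠ k) (s t : ℤ) (hs : 0 ≤ s)
    (ht : 0 ≤ t) (he : e = s + t) : InArr A i j s ∨ InArr A j k t := by
  by_contra hcon
  push Not at hcon
  lift s to ℕ using hs
  lift t to ℕ using ht
  refine hst i j k hij hjk (h.ne hA) s t (by simpa [InArr] using hcon.1)
    (by simpa [InArr] using hcon.2) ?_
  subst he
  simpa [InArr] using h

/-- The set of points on the same side as `z` of every hyperplane of `A`. -/
def faceThrough (A : Set (Set (Fin n → ℝ))) (z : Fin n → ℝ) : Set (Fin n → ℝ) :=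
  {x | ∀ i j (c : ℝ), hyp n i j c ∈ A → (c < x i - x j ↔ c < z i - z j)}

theorem lt_iff_of_mem_faceThrough {x z : Fin n → ℝ} (h : x ∈ faceThrough A z) {i j : Fin n} {c : ℝ}
    (hA : hyp n i j c ∈ A) : x i - x j < c ↔ z i - z j < c := by
  have := h j i (-c) (by rwa [← hyp_symm])
  constructor <;> intro h1
  · linarith [this.1 (by linarith)]
  · linarith [this.2 (by linarith)]

theorem eq_iff_of_mem_faceThrough {x z : Fin n → ℝ} (h : x ∈ faceThrough A z) {i j : Fin n} {c : ℝ}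
    (hA : hyp n i j c ∈ A) : x i - x j = c ↔ z i - z j = c := by
  have h1 := h i j c hA
  have h2 := lt_iff_of_mem_faceThrough h hA
  constructor <;> intro h3
  · exact le_antisymm (not_lt.1 fun h4 => by linarith [h1.2 h4])
      (not_lt.1 fun h4 => by linarith [h2.2 h4])
  · exact le_antisymm (not_lt.1 fun h4 => by linarith [h1.1 h4])
      (not_lt.1 fun h4 => by linarith [h2.1 h4])

theorem isFace_faceThrough (hA : A ⊆ catArr m n) (z : Fin n → ℝ) : IsFace n A (faceThrough A z) := by
  refine ⟨⟨z, fun i j c _ => Iff.rfl⟩,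
    fun H => {x | ∀ i j (c : ℝ), H = hyp n i j c → (c < x i - x j ↔ c < z i - z j)}, ?_, ?_⟩
  · intro H hH
    obtain ⟨i, j, s, hij, -, -, rfl⟩ := hA hH
    have hiff : ∀ x : Fin n → ℝ, (∀ a b (c : ℝ), hyp n i j s = hyp n a b c →
        (c < x a - x b ↔ c < z a - z b)) ↔
        (((s : ℝ) < x i - x j ↔ (s : ℝ) < z i - z j) ∧ (x i - x j < s ↔ z i - z j < s)) := by
      intro x
      constructor
      · intro h
        refine ⟨h i j s rfl, ?_⟩
        have := h j i (-s) (hyp_symm _ _ _)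
        constructor <;> intro h1
        · linarith [this.1 (by linarith)]
        · linarith [this.2 (by linarith)]
      · rintro ⟨h1, h2⟩ a b c h
        rcases hyp_eq_hyp hij.ne h.symm with ⟨rfl, rfl, rfl⟩ | ⟨rfl, rfl, rfl⟩
        · exact h1
        · constructor <;> intro h3
          · linarith [h2.1 (by linarith)]
          · linarith [h2.2 (by linarith)]
    simp only [hiff]
    rcases lt_trichotomy (z i - z j) s with h | h | h
    · refine Or.inr ⟨i, j, s, hij.ne, rfl, Or.inl ?_⟩
      ext x
      simp only [Set.mem_ofPred_eq, h, iff_true, not_lt.2 h.le, iff_false, not_lt]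
      exact ⟨fun h => h.2, fun h => ⟨h.le, h⟩⟩
    · left
      ext x
      simp only [Set.mem_ofPred_eq, h, lt_self_iff_false, iff_false, not_lt, hyp]
      exact ⟨fun h => le_antisymm h.1 h.2, fun h => ⟨h.le, h.ge⟩⟩
    · refine Or.inr ⟨i, j, s, hij.ne, rfl, Or.inr ?_⟩
      ext x
      simp only [Set.mem_ofPred_eq, h, iff_true, not_lt.2 h.le, iff_false, not_lt]
      exact ⟨fun h => h.1, fun h => ⟨h, h.le⟩⟩
  · ext x
    simp only [Set.mem_iInter, Set.mem_ofPred_eq, faceThrough]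
    constructor
    · rintro h H hH i j c rfl
      exact h i j c hH
    · exact fun h i j c hc => h _ hc i j c rfl

theorem IsFace.eq_faceThrough (hA : A ⊆ catArr m n) {F : Set (Fin n → ℝ)} (hF : IsFace n A F)
    {z : Fin n → ℝ} (hz : z ∈ F) : F = faceThrough A z := by
  obtain ⟨-, σ, hσ, rfl⟩ := hF
  have hz' : ∀ H ∈ A, z ∈ σ H := by simpa using hz
  ext x
  simp only [Set.mem_iInter]
  constructor
  · intro hx i j c hc
    have h1 := hx _ hc
    have h2 := hz' _ hc
    rcases hσ _ hc with h | ⟨a, b, s, hab, he, h⟩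
    · rw [h] at h1 h2
      have h1' : x i - x j = c := h1
      have h2' : z i - z j = c := h2
      rw [h1', h2']
    · rcases hyp_eq_hyp hab he with ⟨rfl, rfl, rfl⟩ | ⟨rfl, rfl, rfl⟩ <;> rcases h with h | h <;>
        rw [h] at h1 h2 <;> simp only [Set.mem_ofPred_eq] at h1 h2 <;> constructor <;> intro h3 <;>
        linarith
  · intro hx H hH
    have h2 := hz' _ hH
    rcases hσ _ hH with h | ⟨i, j, s, hij, rfl, h | h⟩
    · rw [h] at h2 ⊢
      obtain ⟨i, j, c, -, -, -, rfl⟩ := hA hH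
      exact (eq_iff_of_mem_faceThrough hx hH).2 h2
    · rw [h] at h2 ⊢
      exact (lt_iff_of_mem_faceThrough hx hH).2 h2
    · rw [h] at h2 ⊢
      exact (hx _ _ _ hH).2 h2

variable {T : LTree m n} {μ : Set (Fin n)}

theorem mem_PhiBar_of_above (x : Fin n → ℝ)
    (h1 : ∀ i ∈ μ, ∀ j s, T.IsChild i j s → x i - x j = (s : ℝ))
    (h2 : ∀ i j : Fin n, ∀ s : ℕ, s ≤ m → ¬ simMu T μ i j →
      (T.Above i j s → (s : ℝ) < x i - x j) ∧ (¬ T.Above i j s → x i - x j < s)) :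
    x ∈ PhiBar m n A T μ := by
  refine ⟨h1, fun i j s ht hs => ?_⟩
  rw [LTree.vlt_iff_not_above ht.1.2.1, LTree.vge_iff_above ht.1.2.1]
  exact (h2 i j s ht.1.1 hs).symm

theorem PhiBar_sign (hA : A ⊆ catArr m n) {x : Fin n → ℝ} (hx : x ∈ PhiBar m n A T μ)
    {i j : Fin n} {c : ℤ} (hc : InArr A i j c) (hs : ¬ simMu T μ i j) :
    (T.Above i j c → (c : ℝ) < x i - x j) ∧ (¬ T.Above i j c → x i - x j < c) := by
  have hij := hc.ne hA
  have hb := hc.bound hA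
  by_cases h : 0 < c ∨ (c = 0 ∧ j < i)
  · have hc0 : 0 ≤ c := by omega
    lift c to ℕ using hc0
    have := hx.2 i j c ⟨⟨by omega, hij, by omega⟩, by simpa [InArr] using hc⟩ hs
    rw [LTree.vlt_iff_not_above hij, LTree.vge_iff_above hij] at this
    simpa using this.symm
  · have hlt : c = 0 → i < j := fun h0 => by
      push Not at h
      exact lt_of_le_of_ne (h.2 h0) hij
    obtain ⟨d, hd⟩ : ∃ d : ℕ, c = -(d : ℤ) := ⟨(-c).toNat, by omega⟩
    subst hd
    have hc' := hc.symm (d := d) (by simp)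
    have := hx.2 j i d ⟨⟨by omega, hij.symm, by
      by_cases h0 : d = 0
      · exact Or.inr (hlt (by omega))
      · left; omega⟩, by simpa [InArr] using hc'⟩ (fun h => hs (simMu_symm h))
    rw [LTree.vlt_iff_not_above hij.symm, LTree.vge_iff_above hij.symm] at this
    rw [LTree.not_above_iff hij.symm] at this
    rw [LTree.not_above_iff hij]
    push_cast
    rw [neg_neg]
    constructor
    · intro h; linarith [this.1 h]
    · intro h; linarith [this.2 h]

/-- A point of the polyhedron of a marked tree. -/
noncomputable def treePt (T : LTree m n) (μ : Set (Fin n)) : Fin n → ℝ :=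
  ptOf T.drift (blockRank T μ)

theorem treePt_mem (hμ : IsMarking T μ) : treePt T μ ∈ PhiBar m n A T μ := by
  apply mem_PhiBar_of_above
  · intro i hi j s h
    have := (ptOf_eq_iff (d := T.drift) (blockRank_le T μ) i j s).2
      ⟨by have := h.drift_eq; omega, ((blockRank_eq_iff hμ).2 (simMu_of_mem hi h)).symm⟩
    simpa [treePt] using this
  · intro i j s _ hs
    have h1 := ptOf_lt_iff (d := T.drift) (blockRank_le T μ) i j s
    have h2 := ptOf_eq_iff (d := T.drift) (blockRank_le T μ) i j s
    rw [← above_iff_blockRank hμ hs] at h1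
    simp only [Int.cast_natCast] at h1 h2
    refine ⟨h1.2, fun h => lt_of_le_of_ne (not_lt.1 fun h' => h (h1.1 h')) fun h' => ?_⟩
    exact hs ((blockRank_eq_iff hμ).1 (h2.1 h').2.symm)

theorem PhiBar_eq_faceThrough (hA : A ⊆ catArr m n) (hT : (T, μ) ∈ OTset m n A)
    {z : Fin n → ℝ} (hz : z ∈ PhiBar m n A T μ) : PhiBar m n A T μ = faceThrough A z := by
  obtain ⟨-, hconn, -⟩ := hT
  ext x
  constructor
  · intro hx i j c hc
    obtain ⟨-, s, rfl, -⟩ := of_hyp_mem hA hc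
    by_cases hs : simMu T μ i j
    · rw [sub_eq_of_simMu hx.1 hs, sub_eq_of_simMu hz.1 hs]
    · have h1 := PhiBar_sign hA hx hc hs
      have h2 := PhiBar_sign hA hz hc hs
      by_cases ha : T.Above i j s
      · exact iff_of_true (h1.1 ha) (h2.1 ha)
      · exact iff_of_false (h1.2 ha).not_gt (h2.2 ha).not_gt
  · intro hx
    have hblock : ∀ i j, simMu T μ i j → x i - x j = (T.drift i : ℝ) - T.drift j := by
      intro i j hij
      have hw := hconn _ ⟨i, rfl⟩ i (simMu_refl i) j hij
      clear hij
      induction hw with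
      | refl => simp
      | tail _ hbc ih =>
        obtain ⟨hb, hc, hbc⟩ := hbc
        have h1 := sub_eq_of_simMu hz.1 (simMu_trans (simMu_symm hb) hc)
        have h2 := (eq_iff_of_mem_faceThrough hx hbc).2 h1
        linarith
    refine ⟨fun i hi j s h => ?_, fun i j s ht hs => ?_⟩
    · rw [hblock i j (simMu_of_mem hi h), h.drift_eq]
      push_cast; ring
    · have h1 := hz.2 i j s ht hs
      exact ⟨fun h => (lt_iff_of_mem_faceThrough hx ht.2).2 (h1.1 h),
        fun h => (hx _ _ _ ht.2).2 (h1.2 h)⟩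

theorem isFace_PhiBar (hA : A ⊆ catArr m n) (hT : (T, μ) ∈ OTset m n A) :
    IsFace n A (PhiBar m n A T μ) := by
  rw [PhiBar_eq_faceThrough hA hT (treePt_mem hT.1)]
  exact isFace_faceThrough hA _

end Braid

namespace Braid

open Filter Topology

variable {m n : ℕ} {A : Set (Set (Fin n → ℝ))} {T : LTree m n} {μ : Set (Fin n)}

/-- Strict inequalities persist under small perturbations. -/
theorem eventually_lt_sub (z v : Fin n → ℝ) (m : ℕ) : ∀ᶠ δ in 𝓝 (0 : ℝ), ∀ i j : Fin n,
    ∀ c ∈ Set.Icc (-(m : ℤ)) m,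
      ((c : ℝ) < z i - z j → (c : ℝ) < (z + δ • v) i - (z + δ • v) j) ∧
        (z i - z j < c → (z + δ • v) i - (z + δ • v) j < c) := by
  rw [eventually_all]; intro i
  rw [eventually_all]; intro j
  rw [eventually_all_finite (Set.finite_Icc _ _)]; intro c _
  have hcont : Continuous fun δ : ℝ => (z + δ • v) i - (z + δ • v) j := by
    simp only [Pi.add_apply, Pi.smul_apply, smul_eq_mul]; fun_prop
  have ht := hcont.tendsto 0
  simp only [zero_smul, add_zero] at ht
  rw [eventually_and]
  constructor
  · by_cases h : (c : ℝ) < z i - z j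
    · filter_upwards [ht.eventually (lt_mem_nhds h)] with δ hδ _ using hδ
    · exact Eventually.of_forall fun _ h' => absurd h' h
  · by_cases h : z i - z j < c
    · filter_upwards [ht.eventually (gt_mem_nhds h)] with δ hδ _ using hδ
    · exact Eventually.of_forall fun _ h' => absurd h' h

theorem ncard_eq_faceCodim (hμ : IsMarking T μ) :
    μ.ncard = faceCodim n (PhiBar m n A T μ) := by
  classical
  have hμ' := hμ
  choose! par s hpar using hμ'
  have hch : ∀ i ∈ μ, T.IsChild i (par i) (s i) := fun i hi => (hpar i hi).1.1
  let L : (Fin n → ℝ) →ₗ[ℝ] (μ → ℝ) :=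
    LinearMap.pi fun i => (LinearMap.proj i.1 : (Fin n → ℝ) →ₗ[ℝ] ℝ) - LinearMap.proj (par i.1)
  have hL : ∀ v (i : μ), L v i = v i.1 - v (par i.1) := fun v i => rfl
  have hsurj : Function.Surjective L := by
    intro w
    refine ⟨fun i => ∑ k : μ, if T.path k.1 <+: T.path i then w k else 0, ?_⟩
    ext i
    rw [hL, ← Finset.sum_sub_distrib, Finset.sum_eq_single i]
    · have hp : T.path i.1 = T.path (par i.1) ++ [s i.1] := hch i.1 i.2
      have : ¬ T.path i.1 <+: T.path (par i.1) := fun h => by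
        have := h.length_le
        simp [hp] at this
      simp [this]
    · intro k _ hk
      have hp : T.path i.1 = T.path (par i.1) ++ [s i.1] := hch i.1 i.2
      have : T.path k.1 <+: T.path i.1 ↔ T.path k.1 <+: T.path (par i.1) := by
        rw [hp, List.prefix_concat_iff]
        constructor
        · rintro (h | h)
          · exact absurd (Subtype.ext (T.inj (h.trans hp.symm))) hk
          · exact h
        · exact Or.inr
      simp [this]
    · simp
  have hz := treePt_mem (A := A) hμ
  set z := treePt T μ
  have hdir : (affineSpan ℝ (PhiBar m n A T μ)).direction = LinearMap.ker L := by
    apply le_antisymm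
    · rw [direction_affineSpan, vectorSpan, Submodule.span_le]
      rintro _ ⟨x, hx, y, hy, rfl⟩
      rw [SetLike.mem_coe, LinearMap.mem_ker]
      ext i
      have h1 := hx.1 i.1 i.2 _ _ (hch i.1 i.2)
      have h2 := hy.1 i.1 i.2 _ _ (hch i.1 i.2)
      rw [hL]
      simp only [vsub_eq_sub, Pi.sub_apply, Pi.zero_apply]
      linarith
    · intro v hv
      have hv' : ∀ i ∈ μ, v i = v (par i) := fun i hi => by
        have := congrFun (LinearMap.mem_ker.1 hv) ⟨i, hi⟩
        rw [hL] at this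
        exact sub_eq_zero.1 this
      have hev := (eventually_lt_sub z v m).filter_mono (nhdsWithin_le_nhds (s := Set.Ioi 0))
      obtain ⟨δ, hδ, hδ0⟩ := (hev.and self_mem_nhdsWithin).exists
      have hδ0 : 0 < δ := hδ0
      have hmem : z + δ • v ∈ PhiBar m n A T μ := by
        refine ⟨fun i hi j t h => ?_, fun i j t ht hs => ?_⟩
        · obtain ⟨rfl, rfl⟩ := h.parent_unique (hch i hi)
          have := hz.1 i hi _ _ h
          simp only [Pi.add_apply, Pi.smul_apply, smul_eq_mul, hv' i hi]
          linarith
        · have h1 := hz.2 i j t ht hs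
          have h2 := hδ i j t ⟨by omega, by have := ht.1.1; omega⟩
          simp only [Int.cast_natCast] at h2
          exact ⟨fun h => h2.2 (h1.1 h), fun h => h2.1 (h1.2 h)⟩
      have h3 := AffineSubspace.vsub_mem_direction (mem_affineSpan ℝ hmem) (mem_affineSpan ℝ hz)
      have h4 : (z + δ • v) -ᵥ z = δ • v := by simp
      rw [h4] at h3
      have := Submodule.smul_mem _ δ⁻¹ h3
      rwa [smul_smul, inv_mul_cancel₀ hδ0.ne', one_smul] at this
  unfold faceCodim
  rw [hdir, (L.quotKerEquivOfSurjective hsurj).finrank_eq, Module.finrank_fintype_fun_eq_card,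
    Set.ncard_eq_toFinset_card', Set.toFinset_card]

end Braid

namespace Braid

variable {m n : ℕ} {A : Set (Set (Fin n → ℝ))} {T T' : LTree m n} {μ μ' : Set (Fin n)}

/-- The combinatorial consequences of two marked trees in `OTset m n A` giving the same face. -/
structure SameFace (A : Set (Set (Fin n → ℝ))) (T : LTree m n) (μ : Set (Fin n)) (T' : LTree m n)
    (μ' : Set (Fin n)) : Prop where
  left_mem : IsMarking T μ ∧ AConnected A T μ ∧ CadetCond A T μ
  right_mem : IsMarking T' μ' ∧ AConnected A T' μ' ∧ CadetCond A T' μ'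
  sim_iff : ∀ i j, simMu T μ i j ↔ simMu T' μ' i j
  drift_sub : ∀ i j, simMu T μ i j →
    (T.drift i : ℤ) - T.drift j = (T'.drift i : ℤ) - T'.drift j
  above_iff_of_inArr : ∀ i j c, InArr A i j c → ¬ simMu T μ i j → (T.Above i j c ↔ T'.Above i j c)

theorem SameFace.symm (h : SameFace A T μ T' μ') : SameFace A T' μ' T μ where
  left_mem := h.right_mem
  right_mem := h.left_mem
  sim_iff i j := (h.sim_iff i j).symm
  drift_sub i j hij := (h.drift_sub i j ((h.sim_iff i j).2 hij)).symm
  above_iff_of_inArr i j c hc hij :=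
    (h.above_iff_of_inArr i j c hc (fun h' => hij ((h.sim_iff i j).1 h'))).symm

theorem sim_of_PhiBar_eq (hT' : IsMarking T' μ')
    (h : PhiBar m n A T μ = PhiBar m n A T' μ') {i j : Fin n} (hij : simMu T μ i j) :
    simMu T' μ' i j ∧ (T.drift i : ℤ) - T.drift j = (T'.drift i : ℤ) - T'.drift j := by
  have hz := treePt_mem (A := A) hT'
  rw [← h] at hz
  have h1 := sub_eq_of_simMu hz.1 hij
  have h2 := (ptOf_eq_iff (d := T'.drift) (blockRank_le T' μ') i j
    ((T.drift i : ℤ) - T.drift j)).1 (by push_cast; exact h1)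
  exact ⟨(blockRank_eq_iff hT').1 h2.2.symm, by omega⟩

theorem sameFace_of_PhiBar_eq (hA : A ⊆ catArr m n) (hT : (T, μ) ∈ OTset m n A)
    (hT' : (T', μ') ∈ OTset m n A) (h : PhiBar m n A T μ = PhiBar m n A T' μ') :
    SameFace A T μ T' μ' where
  left_mem := hT
  right_mem := hT'
  sim_iff i j := ⟨fun hij => (sim_of_PhiBar_eq hT'.1 h hij).1,
    fun hij => (sim_of_PhiBar_eq hT.1 h.symm hij).1⟩
  drift_sub i j hij := (sim_of_PhiBar_eq hT'.1 h hij).2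
  above_iff_of_inArr i j c hc hij := by
    have hz := treePt_mem (A := A) hT.1
    have h1 := PhiBar_sign hA hz hc hij
    have h2 := PhiBar_sign hA (h ▸ hz) hc (fun h' => hij (sim_of_PhiBar_eq hT.1 h.symm h').1)
    constructor
    · intro h3
      by_contra h4
      linarith [h1.1 h3, h2.2 h4]
    · intro h3
      by_contra h4
      linarith [h1.2 h4, h2.1 h3]

namespace SameFace

theorem above_iff_of_sim (h : SameFace A T μ T' μ') {i j : Fin n} (hij : simMu T μ i j) (c : ℤ) :
    T.Above i j c ↔ T'.Above i j c := by
  have hd := h.drift_sub i j hij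
  unfold LTree.Above
  by_cases hc : (T.drift j : ℤ) + c = T.drift i
  · have hc' : (T'.drift j : ℤ) + c = T'.drift i := by omega
    simp only [hc, hc', lt_self_iff_false, true_and, false_or]
    by_cases hd0 : T.drift j = T.drift i
    · rw [dlt_iff_lt_of_simMu h.left_mem.1 (simMu_symm hij) hd0,
        dlt_iff_lt_of_simMu h.right_mem.1 (simMu_symm ((h.sim_iff i j).1 hij)) (by omega)]
    · have key : ∀ {S : LTree m n} {ν : Set (Fin n)}, IsMarking S ν → simMu S ν i j →
          S.drift j ≠ S.drift i → (dlt (S.path j) (S.path i) ↔ S.drift j < S.drift i) := by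
        intro S ν hν hs hne
        rcases hs.markedBelow hν with h1 | h1
        · have h2 := h1.drift_le
          rcases h1.eq_or_dlt with rfl | h3
          · exact absurd rfl hne
          · exact iff_of_false (dlt_asymm h3) (by omega)
        · have h2 := h1.drift_le
          rcases h1.eq_or_dlt with rfl | h3
          · exact absurd rfl hne
          · exact iff_of_true h3 (by omega)
      rw [key h.left_mem.1 hij hd0, key h.right_mem.1 ((h.sim_iff i j).1 hij) (by omega)]
      omega
  · have hc' : ¬ (T'.drift j : ℤ) + c = T'.drift i := by omega
    simp only [hc, hc', false_and, or_false]
    omega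

/-- A pair of nodes ordered differently in the two trees is not separated by a hyperplane of the
arrangement, and neither are their blocks. -/
theorem not_inArr (h : SameFace A T μ T' μ') {l k : Fin n} {u : ℤ} (h1 : T.Above l k u)
    (h2 : ¬ T'.Above l k u) : ¬ simMu T μ l k ∧ ∀ l' k' e, simMu T μ l l' → simMu T μ k k' →
      e = u + ((T.drift l' : ℤ) - T.drift l) - ((T.drift k' : ℤ) - T.drift k) →
      ¬ InArr A l' k' e := by
  have hns : ¬ simMu T μ l k := fun hs => h2 ((h.above_iff_of_sim hs u).1 h1)
  refine ⟨hns, ?_⟩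
  rintro l' k' e hl hk rfl hin
  have hns' : ¬ simMu T μ l' k' := fun h1 =>
    hns (simMu_trans hl (simMu_trans h1 (simMu_symm hk)))
  have h3 := (above_congr h.left_mem.1 hns hl hk u).1 h1
  have h4 := (h.above_iff_of_inArr _ _ _ hin hns').1 h3
  apply h2
  rw [above_congr h.right_mem.1 (fun hs => hns ((h.sim_iff _ _).2 hs)) ((h.sim_iff _ _).1 hl)
    ((h.sim_iff _ _).1 hk) u]
  have e1 := h.drift_sub _ _ hl
  have e2 := h.drift_sub _ _ hk
  convert h4 using 1
  omega

/-- A node in a nontrivial block lies on a hyperplane of the arrangement within its block. -/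
theorem exists_inArr_of_sim (hT : AConnected A T μ) {j a : Fin n}
    (ha : simMu T μ j a) (hne : a ≠ j) :
    ∃ b, simMu T μ j b ∧ InArr A j b ((T.drift j : ℤ) - T.drift b) := by
  have hw := hT _ ⟨j, rfl⟩ j (simMu_refl j) a ha
  rcases Relation.ReflTransGen.cases_head hw with rfl | ⟨b, ⟨-, hb, hjb⟩, -⟩
  · exact absurd rfl hne
  · exact ⟨b, hb, by simpa [InArr] using hjb⟩

/-- Two nodes exchanged between the trees form singleton blocks. -/
theorem singleton_blocks (hA : A ⊆ catArr m n) (hst : IsStronglyTransitive n A)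
    (h : SameFace A T μ T' μ') {l j : Fin n} (h1 : T.Above l j 0) (h2 : ¬ T'.Above l j 0) :
    (∀ a, simMu T μ l a → a = l) ∧ (∀ a, simMu T μ j a → a = j) := by
  obtain ⟨hns, hno⟩ := h.not_inArr h1 h2
  have hlj : l ≠ j := by rintro rfl; exact hns (simMu_refl _)
  constructor
  · intro a ha
    by_contra hne
    obtain ⟨b, hb, hlb⟩ := exists_inArr_of_sim h.left_mem.2.1 ha hne
    have hjb : j ≠ b := by rintro rfl; exact hns hb
    rcases le_total 0 ((T.drift l : ℤ) - T.drift b) with he | he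
    · rcases hlb.split hst hA j hlj hjb 0 _ le_rfl he (by ring) with h3 | h3
      · exact hno l j 0 (simMu_refl _) (simMu_refl _) (by ring) h3
      · exact hno b j _ hb (simMu_refl _) (by ring) (h3.symm (d := (T.drift b : ℤ) - T.drift l)
          (by ring))
    · have hbl := hlb.symm (d := (T.drift b : ℤ) - T.drift l) (by ring)
      rcases hbl.split hst hA j hjb.symm hlj.symm _ 0 (by omega) le_rfl (add_zero _).symm
        with h3 | h3
      · exact hno b j _ hb (simMu_refl _) (by ring) h3
      · exact hno l j 0 (simMu_refl _) (simMu_refl _) (by ring) (h3.symm (by ring))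
  · intro a ha
    by_contra hne
    obtain ⟨b, hb, hjb⟩ := exists_inArr_of_sim h.left_mem.2.1 ha hne
    have hlb : l ≠ b := by rintro rfl; exact hns (simMu_symm hb)
    rcases le_total 0 ((T.drift j : ℤ) - T.drift b) with he | he
    · rcases hjb.split hst hA l hlj.symm hlb 0 _ le_rfl he (by ring) with h3 | h3
      · exact hno l j 0 (simMu_refl _) (simMu_refl _) (by ring) (h3.symm (by ring))
      · exact hno l b _ (simMu_refl _) hb (by ring) h3
    · have hbj := hjb.symm (d := (T.drift b : ℤ) - T.drift j) (by ring)
      rcases hbj.split hst hA l hlb.symm hlj _ 0 (by omega) le_rfl (add_zero _).symm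
        with h3 | h3
      · exact hno l b _ (simMu_refl _) hb (by ring) (h3.symm (d := (T.drift j : ℤ) - T.drift b)
          (by ring))
      · exact hno l j 0 (simMu_refl _) (simMu_refl _) (by ring) h3

/-- The position `s` of a node `p` with a child to the right of `s` is not exchanged with a node
`l` between `p + s` and the children to the right of `s`. -/
theorem not_exchanged_of_noncadet (hA : A ⊆ catArr m n) (hst : IsStronglyTransitive n A)
    (h : SameFace A T μ T' μ') {l p q : Fin n} {s t : ℕ} (hq : T.IsCadet q p t) (hst' : s < t)
    (h1 : T.Above l p s) (hlq : T.Above l q ((s : ℤ) - t)) : T'.Above l p s := by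
  by_contra h2
  obtain ⟨hns, hno⟩ := h.not_inArr h1 h2
  have hdq : (T.drift q : ℤ) = T.drift p + t := by exact_mod_cast hq.1.drift_eq
  by_cases hqm : q ∈ μ
  · have hqp := simMu_of_mem hqm hq.1
    have hw := h.left_mem.2.1 _ ⟨p, rfl⟩ q (simMu_symm hqp) p (simMu_refl p)
    have hcross : ∀ a, Relation.ReflTransGen (fun a b => a ∈ {j | simMu T μ p j} ∧
        b ∈ {j | simMu T μ p j} ∧ hyp n a b ((T.drift a : ℝ) - (T.drift b : ℝ)) ∈ A) a p →
        T.drift p + s < T.drift a → ∃ a b, simMu T μ p a ∧ simMu T μ p b ∧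
          InArr A a b ((T.drift a : ℤ) - T.drift b) ∧ T.drift p + s < T.drift a ∧
          T.drift b ≤ T.drift p + s := by
      intro a ha
      induction ha using Relation.ReflTransGen.head_induction_on with
      | refl => intro h; omega
      | @head a b hab _ ih =>
        intro hlt
        by_cases hb : T.drift p + s < T.drift b
        · exact ih hb
        · exact ⟨a, b, hab.1, hab.2.1, by simpa [InArr] using hab.2.2, hlt, by omega⟩
    obtain ⟨a, b, ha, hb, hab, hlta, hltb⟩ := hcross q hw (by omega)
    have hal : a ≠ l := by rintro rfl; exact hns (simMu_symm ha)
    have hlb : l ≠ b := by rintro rfl; exact hns (simMu_symm hb)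
    rcases hab.split hst hA l hal hlb ((T.drift a : ℤ) - T.drift p - s)
      ((T.drift p : ℤ) + s - T.drift b) (by omega) (by omega) (by ring) with h3 | h3
    · exact hno l a _ (simMu_refl _) ha rfl (h3.symm (by ring))
    · exact hno l b _ (simMu_refl _) hb (by ring) h3
  · rcases h.left_mem.2.2 q p t hq hqm with ⟨rfl, -⟩ | ⟨q', p', hqq', hpp', hin⟩
    · omega
    have hin : InArr A q' p' ((T.drift q' : ℤ) - T.drift p') := by simpa [InArr] using hin
    have hd1 := (hqq'.markedBelow_of_notMem h.left_mem.1 hqm).drift_le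
    have hd2 := (hpp'.markedBelow_of_cadet_notMem h.left_mem.1 hq hqm).drift_le
    have hqp : T'.Above q p t := by
      by_contra h3
      exact (h.not_inArr hq.1.above h3).2 q' p' _ hqq' hpp' (by omega) hin
    have hnlq : ¬ simMu T μ l q := by
      intro hs
      have hd3 := ((simMu_symm hs).markedBelow_of_notMem h.left_mem.1 hqm).drift_le
      have hd4 := h.drift_sub _ _ hs
      have h3 : T'.Above l q 0 := by
        rw [← h.above_iff_of_sim hs]
        rcases ((simMu_symm hs).markedBelow_of_notMem h.left_mem.1 hqm).eq_or_dlt with rfl | h4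
        · exact absurd (hqp.mono (by omega)) h2
        · rcases hd3.eq_or_lt with h5 | h5
          · exact Or.inr ⟨by omega, h4⟩
          · left; omega
      exact h2 ((h3.trans hqp).mono (by omega))
    have hq'l : q' ≠ l := by rintro rfl; exact hnlq (simMu_symm hqq')
    have hlp' : l ≠ p' := by rintro rfl; exact hns (simMu_symm hpp')
    rcases hin.split hst hA l hq'l hlp' ((T.drift q' : ℤ) - T.drift p - s)
      ((T.drift p : ℤ) + s - T.drift p') (by omega) (by omega) (by ring) with h3 | h3
    · have h4 : T'.Above l q ((s : ℤ) - t) := by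
        by_contra h4
        exact (h.not_inArr hlq h4).2 l q' _ (simMu_refl _) hqq' rfl (h3.symm (by omega))
      exact h2 ((h4.trans hqp).mono (by omega))
    · exact hno l p' _ (simMu_refl _) hpp' (by ring) h3

/-- In an exchanged pair with no exchanged pair before it, the shift is zero and the labels
decrease. -/
theorem lt_of_exchanged (hA : A ⊆ catArr m n) (hst : IsStronglyTransitive n A)
    (h : SameFace A T μ T' μ') {l k : Fin n} {u : ℤ} (hu : 0 ≤ u) (h1 : T.Above l k u)
    (h2 : ¬ T'.Above l k u)
    (ih : ∀ p : Fin n, ∀ s : ℕ, p ≠ k → T.Above l p s → T.Above p k (u - s) →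
      T'.Above p k (u - s)) : u = 0 ∧ l < k := by
  suffices hchain : ∀ N : ℕ, ∀ j, T.height j = N → T.Above j k u →
      (j = l ∨ (T.Above l j 0 ∧ ¬ T'.Above l j 0 ∧ l < j)) → u = 0 ∧ l < k from
    hchain _ l rfl h1 (Or.inl rfl)
  intro N
  induction N using Nat.strong_induction_on with
  | _ N IH =>
    intro j hN hjk hj
    obtain ⟨p, s, hp⟩ := hjk.exists_parent hu
    have hlp : T.Above l p s := by
      rcases hj with rfl | ⟨hlj, -⟩
      · exact hp.above
      · simpa using hlj.trans hp.above
    have hnlp : ¬ T'.Above l p s := by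
      intro hcon
      rcases hp.pred hu hjk with ⟨rfl, hus⟩ | hpk
      · exact h2 (hus ▸ hcon)
      · by_cases hpk' : p = k
        · subst hpk'
          rw [LTree.above_self_iff] at hpk
          exact h2 (hcon.mono (by omega))
        · have := hcon.trans (ih p s hpk' hlp hpk)
          exact h2 (this.mono (by omega))
    obtain ⟨hns, hno⟩ := h.not_inArr hlp hnlp
    obtain ⟨q, t, hq, hst'⟩ := hp.exists_cadet
    rcases hst'.lt_or_eq with hlt | rfl
    · exfalso
      have hjq : T.Above j q ((s : ℤ) - t) := by
        refine Or.inr ⟨?_, ?_⟩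
        · have := hp.drift_eq
          have := hq.1.drift_eq
          omega
        · have e1 : T.path j = T.path p ++ [s] := hp
          have e2 : T.path q = T.path p ++ [t] := hq.1
          rw [e1, e2, dlt_append_left]
          exact Or.inl hlt
      have hlq : T.Above l q ((s : ℤ) - t) := by
        rcases hj with rfl | ⟨hlj, -⟩
        · exact hjq
        · simpa using hlj.trans hjq
      exact hnlp (h.not_exchanged_of_noncadet hA hst hq hlt hlp hlq)
    · obtain rfl := hq.1.child_unique hp
      have hqm : q ∉ μ := by
        intro hm
        have hs := simMu_of_mem hm hp
        rcases hj with rfl | ⟨hlj, hlj', -⟩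
        · exact hns hs
        · exact hp.ne.symm ((h.singleton_blocks hA hst hlj hlj').2 p hs)
      rcases h.left_mem.2.2 q p s hq hqm with ⟨rfl, hlt⟩ | ⟨q', p', hqq', hpp', hin⟩
      · have hlp' : l < p := by
          rcases hj with rfl | ⟨-, -, hlj⟩
          · exact hlt
          · exact hlj.trans hlt
        by_cases hpk : p = k
        · subst hpk
          refine ⟨?_, hlp'⟩
          rcases hp.pred hu hjk with ⟨-, h3⟩ | h3
          · exact_mod_cast h3
          · rw [LTree.above_self_iff] at h3
            simp at h3
            omega
        · have hpk' : T.Above p k u := by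
            rcases hp.pred hu hjk with ⟨h3, -⟩ | h3
            · exact absurd h3.symm hpk
            · simpa using h3
          refine IH (T.height p) ?_ p rfl hpk' (Or.inr ⟨by simpa using hlp, by simpa using hnlp, hlp'⟩)
          have := LTree.above_iff_height.1 hp.above
          simp at this
          omega
      · exfalso
        have hin : InArr A q' p' ((T.drift q' : ℤ) - T.drift p') := by simpa [InArr] using hin
        have hd2 := (hpp'.markedBelow_of_cadet_notMem h.left_mem.1 hq hqm).drift_le
        have hdq : (T.drift q : ℤ) = T.drift p + s := by exact_mod_cast hp.drift_eq
        rcases hj with rfl | ⟨hlj, hlj', -⟩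
        · exact hno q' p' _ hqq' hpp' (by omega) hin
        · have hsing := h.singleton_blocks hA hst hlj hlj'
          obtain rfl := hsing.2 q' hqq'
          obtain ⟨hns', hno'⟩ := h.not_inArr hlj hlj'
          have hql : q' ≠ l := by rintro rfl; exact hns' (simMu_refl _)
          have hlp' : l ≠ p' := by rintro rfl; exact hns (simMu_symm hpp')
          rcases hin.split hst hA l hql hlp' 0 ((T.drift q' : ℤ) - T.drift p') le_rfl (by omega)
            (by ring) with h3 | h3
          · exact hno' l q' 0 (simMu_refl _) (simMu_refl _) (by ring) (h3.symm (by ring))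
          · exact hno l p' _ (simMu_refl _) hpp' (by omega) h3

theorem not_exchanged (hA : A ⊆ catArr m n) (hst : IsStronglyTransitive n A) (N : ℕ) :
    ∀ {T T' : LTree m n} {μ μ' : Set (Fin n)}, SameFace A T μ T' μ' → ∀ (l k : Fin n) (u : ℤ),
      0 ≤ u → (T.height l : ℤ) + T'.height k + n * u = N → T.Above l k u → T'.Above l k u := by
  induction N using Nat.strong_induction_on with
  | _ N IH =>
    intro T T' μ μ' h l k u hu hN h1
    by_contra h2
    have hlk : l ≠ k := by
      rintro rfl
      rw [LTree.above_self_iff] at h1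
      omega
    have step : ∀ {T T' : LTree m n} {μ μ' : Set (Fin n)}, SameFace A T μ T' μ' →
        ∀ (l k : Fin n) (u : ℤ), 0 ≤ u → (T.height l : ℤ) + T'.height k + n * u = N →
        T.Above l k u → ¬ T'.Above l k u → u = 0 ∧ l < k := by
      intro T T' μ μ' h l k u hu hN h1 h2
      refine h.lt_of_exchanged hA hst hu h1 h2 ?_
      intro p s hpk hlp hpu
      have hh := LTree.above_iff_height.1 hlp
      have hs0 : (0 : ℤ) ≤ n * s := by positivity
      rcases le_total 0 (u - s) with hus | hus
      · have hm : (0 : ℤ) ≤ n * (u - s) := by positivity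
        have e : (n : ℤ) * (u - s) = n * u - n * s := by ring
        refine IH ((T.height p : ℤ) + T'.height k + n * (u - s)).toNat ?_ h p k _ hus ?_ hpu
        · omega
        · omega
      · by_contra h4
        rw [LTree.not_above_iff hpk] at h4
        have hus' : 0 ≤ -(u - s) := by omega
        have hm : (0 : ℤ) ≤ n * (-(u - s)) := by positivity
        have hm' : (0 : ℤ) ≤ n * u := by positivity
        have e : (n : ℤ) * (-(u - s)) = n * s - n * u := by ring
        have := IH ((T'.height k : ℤ) + T.height p + n * (-(u - s))).toNat (by omega) h.symm k p _
          hus' (by omega) h4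
        exact hpu.asymm this
    obtain ⟨rfl, hlt⟩ := step h l k u hu hN h1 h2
    have h3 : ¬ T.Above k l 0 := by simpa using h1.asymm
    have h4 : T'.Above k l 0 := by
      rw [LTree.not_above_iff hlk] at h2
      simpa using h2
    have := (step h.symm k l 0 le_rfl (by omega) h4 h3).2
    exact absurd hlt this.not_gt

theorem eq (hA : A ⊆ catArr m n) (hst : IsStronglyTransitive n A)
    (h : SameFace A T μ T' μ') : T = T' ∧ μ = μ' := by
  have hTT : T = T' := by
    apply LTree.eq_of_above_iff
    intro i j c _ hc
    have key : ∀ {T T' : LTree m n} {μ μ' : Set (Fin n)}, SameFace A T μ T' μ' →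
        T.Above i j c → T'.Above i j c := fun {T T' _ _} h =>
      not_exchanged hA hst ((T.height i : ℤ) + T'.height j + n * c).toNat h i j c hc
        (by have : (0 : ℤ) ≤ n * c := by positivity
            omega)
    exact ⟨key h, key h.symm⟩
  refine ⟨hTT, ?_⟩
  subst hTT
  have key : ∀ {μ μ' : Set (Fin n)}, SameFace A T μ T μ' → μ ⊆ μ' := by
    intro μ μ' h i hi
    obtain ⟨j, s, hj, -⟩ := h.left_mem.1 i hi
    by_contra hi'
    have h1 := (blockRank_eq_iff h.right_mem.1).2
      ((h.sim_iff i j).1 (simMu_of_mem hi hj.1))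
    have h2 := blockRank_cadet_of_notMem hj hi'
    omega
  exact (key h).antisymm (key h.symm)

end SameFace

end Braid

namespace Braid

variable {m n : ℕ} {x : Fin n → ℝ}

/-- The position of `i` is above that of `j` shifted by `c`, in the real line; ties are broken in
favor of the larger coordinate, and then of the larger label. -/
def PtAbove (x : Fin n → ℝ) (i j : Fin n) (c : ℤ) : Prop :=
  x j + c < x i ∨ (x j + c = x i ∧ (0 < c ∨ (c = 0 ∧ j < i)))

theorem ptAbove_self_iff {i : Fin n} {c : ℤ} : PtAbove x i i c ↔ c < 0 := by
  unfold PtAbove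
  simp only [lt_self_iff_false, and_false, or_false]
  constructor
  · rintro (h | ⟨h, h'⟩)
    · have : (c : ℝ) < 0 := by linarith
      exact_mod_cast this
    · have : (c : ℝ) = 0 := by linarith
      have : c = 0 := by exact_mod_cast this
      omega
  · intro h
    left
    have : (c : ℝ) < 0 := by exact_mod_cast h
    linarith

theorem PtAbove.trans {i j k : Fin n} {c d : ℤ} (h1 : PtAbove x i j c) (h2 : PtAbove x j k d) :
    PtAbove x i k (c + d) := by
  unfold PtAbove at *
  push_cast
  rcases h1 with h1 | ⟨h1, h1'⟩ <;> rcases h2 with h2 | ⟨h2, h2'⟩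
  · left; linarith
  · left; linarith
  · left; linarith
  · refine Or.inr ⟨by linarith, ?_⟩
    rcases h1' with h1' | ⟨h1', h3⟩ <;> rcases h2' with h2' | ⟨h2', h4⟩
    · left; omega
    · left; omega
    · left; omega
    · exact Or.inr ⟨by omega, h4.trans h3⟩

theorem PtAbove.mono {i j : Fin n} {c d : ℤ} (h : PtAbove x i j c) (hd : d ≤ c) :
    PtAbove x i j d := by
  rcases hd.eq_or_lt with rfl | hd
  · exact h
  · have := h.trans (ptAbove_self_iff.2 (show d - c < 0 by omega))
    simpa using this

theorem PtAbove.asymm {i j : Fin n} {c : ℤ} (h : PtAbove x i j c) : ¬ PtAbove x j i (-c) := by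
  intro h'
  have := h.trans h'
  rw [ptAbove_self_iff] at this
  omega

theorem ptAbove_total {i j : Fin n} {c : ℤ} (h : i = j → c ≠ 0) :
    PtAbove x i j c ∨ PtAbove x j i (-c) := by
  unfold PtAbove
  push_cast
  rcases lt_trichotomy (x j + c) (x i) with h1 | h1 | h1
  · exact Or.inl (Or.inl h1)
  · rcases lt_trichotomy c 0 with h2 | h2 | h2
    · exact Or.inr (Or.inr ⟨by linarith, by omega⟩)
    · rcases lt_trichotomy j i with h3 | h3 | h3
      · exact Or.inl (Or.inr ⟨h1, Or.inr ⟨h2, h3⟩⟩)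
      · exact absurd h2 (h h3.symm)
      · exact Or.inr (Or.inr ⟨by linarith, Or.inr ⟨by omega, h3⟩⟩)
    · exact Or.inl (Or.inr ⟨h1, Or.inl h2⟩)
  · exact Or.inr (Or.inl (by linarith))

theorem not_ptAbove_iff {i j : Fin n} (hij : i ≠ j) {c : ℤ} :
    ¬ PtAbove x i j c ↔ PtAbove x j i (-c) := by
  constructor
  · intro h
    exact (ptAbove_total fun h' => absurd h' hij).resolve_left h
  · intro h h'
    exact h'.asymm h

/-- The position of `j` shifted by `s` is the last one before `i`. -/
def IsPred (m : ℕ) (x : Fin n → ℝ) (i j : Fin n) (s : ℕ) : Prop :=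
  s ≤ m ∧ PtAbove x i j s ∧ ∀ (k : Fin n) (u : ℕ), u ≤ m → PtAbove x i k u →
    (k = j ∧ u = s) ∨ PtAbove x j k ((u : ℤ) - s)

theorem exists_isPred {i k : Fin n} {u : ℕ} (hu : u ≤ m) (h : PtAbove x i k u) :
    ∃ j s, IsPred m x i j s := by
  let r : Fin n × Fin (m + 1) → Fin n × Fin (m + 1) → Prop :=
    fun a b => PtAbove x a.1 b.1 ((b.2.1 : ℤ) - a.2.1)
  have hirr : Std.Irrefl r := ⟨fun a ha => by
    have := ptAbove_self_iff.1 ha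
    omega⟩
  have htr : IsTrans _ r := ⟨fun a b c h1 h2 => by
    have := h1.trans h2
    refine this.mono (by omega)⟩
  have hwf : WellFounded r := Finite.wellFounded_of_trans_of_irrefl r
  obtain ⟨⟨j, s⟩, hjs, hmin⟩ := hwf.has_min {a | PtAbove x i a.1 a.2.1}
    ⟨(k, ⟨u, by omega⟩), h⟩
  refine ⟨j, s.1, by omega, hjs, fun k' u' hu' h' => ?_⟩
  have h1 := hmin (k', ⟨u', by omega⟩) h'
  by_cases heq : k' = j ∧ u' = s.1
  · exact Or.inl heq
  · right
    have h1 : ¬ PtAbove x k' j ((s.1 : ℤ) - u') := h1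
    have := (ptAbove_total (x := x) (i := k') (j := j) (c := (s.1 : ℤ) - u')
      (fun h2 h3 => heq ⟨h2, by omega⟩)).resolve_left h1
    simpa using this

theorem IsPred.unique {i j j' : Fin n} {s s' : ℕ} (h : IsPred m x i j s)
    (h' : IsPred m x i j' s') : j = j' ∧ s = s' := by
  rcases h.2.2 j' s' h'.1 h'.2.1 with ⟨h1, h2⟩ | h1
  · exact ⟨h1.symm, h2.symm⟩
  · rcases h'.2.2 j s h.1 h.2.1 with ⟨h3, h4⟩ | h3
    · exact ⟨h3, h4⟩
    · exact absurd (by simpa using h3) h1.asymm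

open Classical in
/-- The rank of a coordinate of a point. -/
noncomputable def ptRank (x : Fin n → ℝ) (i : Fin n) : ℕ :=
  (Finset.univ.filter fun k => PtAbove x i k 0).card

theorem ptRank_lt {i j : Fin n} (h : PtAbove x i j 0) : ptRank x j < ptRank x i := by
  apply Finset.card_lt_card
  rw [Finset.ssubset_iff_of_subset]
  · exact ⟨j, by simpa using h, by simp [ptAbove_self_iff]⟩
  · intro k
    simp only [Finset.mem_filter, Finset.mem_univ, true_and]
    exact fun h1 => by simpa using h.trans h1

theorem IsPred.ptRank_lt {i j : Fin n} {s : ℕ} (h : IsPred m x i j s) :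
    ptRank x j < ptRank x i :=
  Braid.ptRank_lt (h.2.1.mono (by omega))

open Classical in
/-- The sequence of shifts obtained by following the last positions before a coordinate. -/
noncomputable def ptPath (m : ℕ) (x : Fin n → ℝ) (i : Fin n) : List ℕ :=
  if h : ∃ p : Fin n × ℕ, IsPred m x i p.1 p.2 then
    ptPath m x h.choose.1 ++ [h.choose.2]
  else []
termination_by ptRank x i
decreasing_by exact h.choose_spec.ptRank_lt

theorem IsPred.ptPath_eq {i j : Fin n} {s : ℕ} (h : IsPred m x i j s) :
    ptPath m x i = ptPath m x j ++ [s] := by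
  have hex : ∃ p : Fin n × ℕ, IsPred m x i p.1 p.2 := ⟨(j, s), h⟩
  rw [ptPath, dif_pos hex]
  obtain ⟨h1, h2⟩ := h.unique hex.choose_spec
  rw [← h1, ← h2]

theorem ptPath_eq_nil {i : Fin n} (h : ¬ ∃ j s, IsPred m x i j s) : ptPath m x i = [] := by
  rw [ptPath, dif_neg]
  rintro ⟨p, hp⟩
  exact h ⟨_, _, hp⟩

theorem ptPath_injective (m : ℕ) (x : Fin n → ℝ) : Function.Injective (ptPath m x) := by
  intro i
  generalize hN : ptRank x i = N
  induction N using Nat.strong_induction_on generalizing i with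
  | _ N ih =>
    intro i' h
    by_contra hne
    have key : ∀ {a b : Fin n}, PtAbove x a b 0 → ∀ {j s}, IsPred m x a j s →
        IsPred m x b j s → False := by
      intro a b hab j s ha hb
      rcases ha.2.2 b 0 (by omega) (by simpa using hab) with ⟨rfl, -⟩ | h1
      · have := ptAbove_self_iff.1 hb.2.1
        omega
      · exact h1.asymm (by simpa using hb.2.1)
    have hpred : ∃ j s, IsPred m x i j s ∧ IsPred m x i' j s := by
      by_cases h1 : ∃ j s, IsPred m x i j s
      · obtain ⟨j, s, hj⟩ := h1
        rw [hj.ptPath_eq] at h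
        by_cases h2 : ∃ j s, IsPred m x i' j s
        · obtain ⟨j', s', hj'⟩ := h2
          rw [hj'.ptPath_eq] at h
          have := List.append_inj' h rfl
          obtain rfl := ih (ptRank x j) (hN ▸ hj.ptRank_lt) rfl this.1
          obtain rfl : s = s' := by simpa using this.2
          exact ⟨j, s, hj, hj'⟩
        · rw [ptPath_eq_nil h2] at h
          simp at h
      · by_cases h2 : ∃ j s, IsPred m x i' j s
        · obtain ⟨j', s', hj'⟩ := h2
          rw [hj'.ptPath_eq, ptPath_eq_nil h1] at h
          simp at h
        · exfalso
          rcases ptAbove_total (x := x) (i := i) (j := i') (c := 0) (fun h => absurd h hne)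
            with h3 | h3
          · exact h1 (exists_isPred (u := 0) (by omega) (by simpa using h3))
          · exact h2 (exists_isPred (u := 0) (by omega) (by simpa using h3))
    obtain ⟨j, s, h1, h2⟩ := hpred
    rcases ptAbove_total (x := x) (i := i) (j := i') (c := 0) (fun h => absurd h hne)
      with h3 | h3
    · exact key h3 h1 h2
    · exact key (by simpa using h3) h2 h1

/-- The tree of a point. -/
noncomputable def treeOf (m : ℕ) (x : Fin n → ℝ) : LTree m n where
  path := ptPath m x
  entry_le := by
    intro i
    generalize hN : ptRank x i = N
    induction N using Nat.strong_induction_on generalizing i with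
    | _ N ih =>
      intro s hs
      by_cases h : ∃ j s, IsPred m x i j s
      · obtain ⟨j, t, hj⟩ := h
        rw [hj.ptPath_eq, List.mem_append, List.mem_singleton] at hs
        rcases hs with hs | rfl
        · exact ih _ (hN ▸ hj.ptRank_lt) j rfl s hs
        · exact hj.1
      · rw [ptPath_eq_nil h] at hs
        simp at hs
  inj := ptPath_injective m x
  parent_closed := by
    intro i hi
    by_cases h : ∃ j s, IsPred m x i j s
    · obtain ⟨j, t, hj⟩ := h
      exact ⟨j, by rw [hj.ptPath_eq, List.dropLast_concat]⟩
    · exact absurd (ptPath_eq_nil h) hi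

theorem isChild_treeOf_iff {i j : Fin n} {s : ℕ} :
    (treeOf m x).IsChild i j s ↔ IsPred m x i j s := by
  constructor
  · intro h
    have h' : ptPath m x i = ptPath m x j ++ [s] := h
    by_cases hp : ∃ j s, IsPred m x i j s
    · obtain ⟨j', t, hj⟩ := hp
      rw [hj.ptPath_eq] at h'
      have := List.append_inj' h' rfl
      obtain rfl := ptPath_injective m x this.1
      obtain rfl : t = s := by simpa using this.2
      exact hj
    · rw [ptPath_eq_nil hp] at h'
      simp at h'
  · exact fun h => h.ptPath_eq

/-- The order of the positions of a point is the order of the vertices of its tree. -/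
theorem above_treeOf_of_ptAbove {i j : Fin n} {c : ℤ} (hc : -(m : ℤ) ≤ c) (hc' : c ≤ m)
    (h : PtAbove x i j c) : (treeOf m x).Above i j c := by
  generalize hN : ptRank x i + ptRank x j = N
  induction N using Nat.strong_induction_on generalizing i j c with
  | _ N ih =>
    rcases le_or_gt 0 c with h0 | h0
    · lift c to ℕ using h0
      obtain ⟨k, u, hk⟩ := exists_isPred (m := m) (by omega) h
      have hki := (isChild_treeOf_iff.2 hk).above
      rcases hk.2.2 j c (by omega) h with ⟨rfl, rfl⟩ | h1
      · exact hki
      · have hlt := hk.ptRank_lt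
        have hk1 := hk.1
        have := ih (ptRank x k + ptRank x j) (by omega) (by omega) (by omega) h1 rfl
        exact (hki.trans this).mono (by omega)
    · by_cases hp : ∃ k u, IsPred m x j k u
      · obtain ⟨k, u, hk⟩ := hp
        have hlt := hk.ptRank_lt
        have hk1 := hk.1
        have hch := isChild_treeOf_iff.2 hk
        have hd := hch.drift_eq
        have h1 : PtAbove x i k (c + u) := h.trans hk.2.1
        have h2 := ih (ptRank x i + ptRank x k) (by omega) (by omega) (by omega) h1 rfl
        rcases h2 with h2 | ⟨h2, h3⟩
        · left; omega
        · refine Or.inr ⟨by omega, ?_⟩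
          have e1 : (treeOf m x).path j = (treeOf m x).path k ++ [u] := hch
          rcases dlt_cases h3 with ⟨e, w, he⟩ | h4
          · rw [e1, he, dlt_append_left]
            have : (treeOf m x).drift i = (treeOf m x).drift k + (e + w.sum) := by
              simp [LTree.drift, he]
            left
            omega
          · simpa [e1] using h4 [u] []
      · left
        have : (treeOf m x).drift j = 0 := by
          simp [LTree.drift, show (treeOf m x).path j = [] from ptPath_eq_nil hp]
        omega

theorem above_treeOf_iff {i j : Fin n} {c : ℤ} (hc : -(m : ℤ) ≤ c) (hc' : c ≤ m) :
    (treeOf m x).Above i j c ↔ PtAbove x i j c := by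
  refine ⟨fun h => ?_, above_treeOf_of_ptAbove hc hc'⟩
  by_cases hij : i = j
  · subst hij
    rw [LTree.above_self_iff] at h
    exact ptAbove_self_iff.2 h
  · by_contra h'
    rw [not_ptAbove_iff hij] at h'
    exact h.asymm (above_treeOf_of_ptAbove (by omega) (by omega) h')

/-- The marked edges of the tree of a point. -/
def marksOf (m : ℕ) (x : Fin n → ℝ) : Set (Fin n) :=
  {i | ∃ j s, (treeOf m x).IsChild i j s ∧ x i - x j = s}

theorem sub_eq_of_mem_marksOf : ∀ i ∈ marksOf m x, ∀ j s, (treeOf m x).IsChild i j s →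
    x i - x j = (s : ℝ) := by
  rintro i ⟨j', s', h', he⟩ j s h
  obtain ⟨rfl, rfl⟩ := h.parent_unique h'
  exact he

theorem isMarking_marksOf (m : ℕ) (x : Fin n → ℝ) : IsMarking (treeOf m x) (marksOf m x) := by
  rintro i ⟨j, s, h, he⟩
  refine ⟨j, s, ⟨h, ?_⟩, ?_⟩
  · rintro t ht htm ⟨k, hk⟩
    have h1 := isChild_treeOf_iff.1 h
    have h2 := isChild_treeOf_iff.1 hk
    have h3 : PtAbove x i k ((s : ℤ) - t) := by
      rw [← above_treeOf_iff (m := m) (by omega) (by omega)]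
      refine Or.inr ⟨by have := h.drift_eq; have := hk.drift_eq; omega, ?_⟩
      have e1 : (treeOf m x).path i = (treeOf m x).path j ++ [s] := h
      have e2 : (treeOf m x).path k = (treeOf m x).path j ++ [t] := hk
      rw [e1, e2, dlt_append_left]
      exact Or.inl ht
    have h4 : x j + t ≤ x k := by
      rcases h2.2.1 with h4 | ⟨h4, -⟩
      · simpa using h4.le
      · simpa using h4.le
    rcases h3 with h5 | ⟨-, h5⟩
    · push_cast at h5
      linarith
    · omega
  · rintro rfl
    rcases (isChild_treeOf_iff.1 h).2.1 with h1 | ⟨-, h1⟩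
    · simp at h1 he
      linarith
    · simpa using h1

theorem simMu_of_sub_eq_nat {i j : Fin n} {s : ℕ} (hs : s ≤ m) (h : x i - x j = s)
    (habove : i = j ∨ PtAbove x i j s) : simMu (treeOf m x) (marksOf m x) i j := by
  generalize hN : ptRank x i = N
  induction N using Nat.strong_induction_on generalizing i s with
  | _ N ih =>
    rcases habove with rfl | habove
    · exact simMu_refl _
    obtain ⟨k, u, hk⟩ := exists_isPred (m := m) hs habove
    have hch := isChild_treeOf_iff.2 hk
    have h4 : x k + u ≤ x i := by
      rcases hk.2.1 with h4 | ⟨h4, -⟩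
      · simpa using h4.le
      · simpa using h4.le
    rcases hk.2.2 j s hs habove with ⟨rfl, rfl⟩ | h1
    · exact simMu_of_mem ⟨_, _, hch, h⟩ hch
    · have h5 : x k + u = x i ∧ 0 ≤ (s : ℤ) - u := by
        rcases h1 with h1 | ⟨h1, h2⟩
        · push_cast at h1; linarith
        · push_cast at h1; exact ⟨by linarith, by omega⟩
      have hm : i ∈ marksOf m x := ⟨k, u, hch, by linarith [h5.1]⟩
      have hus : u ≤ s := by omega
      refine simMu_trans (simMu_of_mem hm hch) (ih _ (hN ▸ hk.ptRank_lt) (s := s - u) (by omega)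
        ?_ (Or.inr ?_) rfl)
      · push_cast [hus]; linarith [h5.1]
      · simpa [hus] using h1

theorem simMu_of_sub_eq {i j : Fin n} {c : ℤ} (hc : -(m : ℤ) ≤ c) (hc' : c ≤ m)
    (h : x i - x j = c) : simMu (treeOf m x) (marksOf m x) i j := by
  by_cases hij : i = j
  · exact hij ▸ simMu_refl _
  rcases ptAbove_total (x := x) (c := c) (fun h' => absurd h' hij) with h1 | h1
  · have h0 : 0 ≤ c := by
      rcases h1 with h1 | ⟨-, h1⟩
      · linarith
      · omega
    lift c to ℕ using h0
    exact simMu_of_sub_eq_nat (by omega) (by simpa using h) (Or.inr h1)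
  · have h0 : 0 ≤ -c := by
      rcases h1 with h1 | ⟨-, h1⟩
      · push_cast at h1; linarith
      · omega
    obtain ⟨d, hd⟩ : ∃ d : ℕ, c = -(d : ℤ) := ⟨(-c).toNat, by omega⟩
    subst hd
    push_cast at h
    exact simMu_symm (simMu_of_sub_eq_nat (s := d) (by omega) (by linarith)
      (Or.inr (by simpa using h1)))

theorem lt_sub_iff_above_treeOf {i j : Fin n} {c : ℤ} (hc : -(m : ℤ) ≤ c) (hc' : c ≤ m)
    (hs : ¬ simMu (treeOf m x) (marksOf m x) i j) :
    (c : ℝ) < x i - x j ↔ (treeOf m x).Above i j c := by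
  rw [above_treeOf_iff hc hc']
  constructor
  · intro h; left; linarith
  · rintro (h | ⟨h, -⟩)
    · linarith
    · exact absurd (simMu_of_sub_eq hc hc' (by linarith)) hs

theorem mem_PhiBar_treeOf (A : Set (Set (Fin n → ℝ))) :
    x ∈ PhiBar m n A (treeOf m x) (marksOf m x) := by
  apply mem_PhiBar_of_above _ sub_eq_of_mem_marksOf
  intro i j s hs hns
  have h1 := lt_sub_iff_above_treeOf (x := x) (c := s) (by omega) (by omega) hns
  simp only [Int.cast_natCast] at h1
  refine ⟨h1.2, fun h => lt_of_le_of_ne (not_lt.1 fun h' => h (h1.1 h')) fun h' => hns ?_⟩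
  exact simMu_of_sub_eq (c := s) (by omega) (by omega) (by simpa using h')

end Braid

namespace Braid

open Filter Topology

variable {m n : ℕ} {A : Set (Set (Fin n → ℝ))} {x : Fin n → ℝ}

/-- The point `x` lies on a hyperplane of `A` of the form `{x a - x b = c}`. -/
def Tight (A : Set (Set (Fin n → ℝ))) (x : Fin n → ℝ) (a b : Fin n) : Prop :=
  hyp n a b (x a - x b) ∈ A

/-- The only small integral differences of coordinates of `x` are those forced by the hyperplanes
of `A` through `x`. -/
def IsGenericIn (m : ℕ) (A : Set (Set (Fin n → ℝ))) (x : Fin n → ℝ) : Prop :=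
  ∀ i j (c : ℤ), -(m : ℤ) ≤ c → c ≤ m → x i - x j = c → Relation.ReflTransGen (Tight A x) i j

theorem Tight.symm {a b : Fin n} (h : Tight A x a b) : Tight A x b a := by
  unfold Tight at *
  rw [hyp_symm]
  simpa using h

theorem exists_isGenericIn (hA : A ⊆ catArr m n) (z : Fin n → ℝ) :
    ∃ y ∈ faceThrough A z, IsGenericIn m A y := by
  let S : Setoid (Fin n) :=
    { r := Relation.ReflTransGen (Tight A z)
      iseqv := ⟨fun _ => .refl, fun h => by
        induction h with
        | refl => exact .refl
        | tail _ hbc ih => exact .head hbc.symm ih, fun h h' => h.trans h'⟩ }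
  let q : Fin n → ℝ := fun i => ((Quotient.mk S i).out : Fin n).val
  have hq : ∀ i j, q i = q j ↔ Relation.ReflTransGen (Tight A z) i j := by
    intro i j
    have h1 : q i = q j ↔ (Quotient.mk S i).out = (Quotient.mk S j).out := by
      simp only [q, Nat.cast_inj, Fin.ext_iff]
    rw [h1, Quotient.out_inj, Quotient.eq]
    rfl
  have hev := (eventually_lt_sub z q m).filter_mono (nhdsWithin_le_nhds (s := Set.Ioi 0))
  obtain ⟨δ, hδ, hδ0⟩ := (hev.and self_mem_nhdsWithin).exists
  have hδ0 : 0 < δ := hδ0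
  have hsub : ∀ i j, (z + δ • q) i - (z + δ • q) j = z i - z j + δ * (q i - q j) := by
    intro i j
    simp only [Pi.add_apply, Pi.smul_apply, smul_eq_mul]; ring
  have htight : ∀ a b, Tight A z a b → (z + δ • q) a - (z + δ • q) b = z a - z b := by
    intro a b h
    rw [hsub, (hq a b).2 (.single h)]; ring
  refine ⟨z + δ • q, ?_, ?_⟩
  · intro i j c hc
    obtain ⟨-, s, rfl, hs1, hs2⟩ := of_hyp_mem hA hc
    have h1 := hδ i j s ⟨hs1, hs2⟩
    rcases lt_trichotomy (z i - z j) s with h | h | h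
    · exact iff_of_false (h1.2 h).not_gt h.not_gt
    · rw [htight i j (by rw [Tight, h]; exact hc)]
    · exact iff_of_true (h1.1 h) h
  · intro i j c hc hc' h
    have h1 := hδ i j c ⟨hc, hc'⟩
    rcases lt_trichotomy (z i - z j) c with h2 | h2 | h2
    · exact absurd h (h1.2 h2).ne
    · rw [hsub, h2] at h
      have h3 : δ * (q i - q j) = 0 := by linarith
      have h4 : q i = q j := by
        rcases mul_eq_zero.1 h3 with h4 | h4
        · exact absurd h4 hδ0.ne'
        · linarith
      refine Relation.ReflTransGen.mono (fun a b hab => ?_) _ _ ((hq i j).1 h4)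
      rw [Tight, htight a b hab]
      exact hab
    · exact absurd h (h1.1 h2).ne'

theorem Tight.simMu (hA : A ⊆ catArr m n) {a b : Fin n} (h : Tight A x a b) :
    simMu (treeOf m x) (marksOf m x) a b := by
  obtain ⟨-, s, hs, h1, h2⟩ := of_hyp_mem hA h
  exact simMu_of_sub_eq h1 h2 hs

theorem IsGenericIn.reflTransGen_tight (hx : IsGenericIn m A x) {i j : Fin n}
    (h : simMu (treeOf m x) (marksOf m x) i j) : Relation.ReflTransGen (Tight A x) i j := by
  induction h with
  | refl => exact .refl
  | tail _ hbc ih =>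
    refine ih.trans ?_
    rcases hbc with ⟨hb, s, hs⟩ | ⟨hc, s, hs⟩
    · exact hx _ _ s (by omega) (by have := hs.le; omega)
        (by simpa using sub_eq_of_mem_marksOf _ hb _ _ hs)
    · have h1 := sub_eq_of_mem_marksOf _ hc _ _ hs
      exact hx _ _ (-s) (by have := hs.le; omega) (by omega) (by push_cast; linarith)

theorem IsGenericIn.aConnected (hA : A ⊆ catArr m n) (hx : IsGenericIn m A x) :
    AConnected A (treeOf m x) (marksOf m x) := by
  rintro B ⟨k, rfl⟩ i hi j hj
  have hw := hx.reflTransGen_tight (simMu_trans (simMu_symm hi) hj)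
  clear hj
  induction hw using Relation.ReflTransGen.head_induction_on with
  | refl => exact .refl
  | @head a b hab _ ih =>
    have hs := hab.simMu hA
    have hb := simMu_trans hi hs
    refine .head ⟨hi, hb, ?_⟩ (ih hb)
    rw [← sub_eq_of_simMu sub_eq_of_mem_marksOf hs]
    exact hab

open Classical in
/-- The number of hyperplanes `{x i - x j = s}`, for `(i,j,s)` in `Tr_m^n`, below `x`. -/
noncomputable def numBelow (m : ℕ) (x : Fin n → ℝ) : ℕ :=
  (Finset.univ.filter fun p : Fin n × Fin n × Fin (m + 1) =>
    TrIdx m n p.1 p.2.1 p.2.2 ∧ ((p.2.2 : ℕ) : ℝ) < x p.1 - x p.2.1).card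

theorem swap_lt_swap_iff {ρ a b : ℕ} (h1 : ¬ (a = ρ ∧ b = ρ + 1))
    (h2 : ¬ (a = ρ + 1 ∧ b = ρ)) :
    Equiv.swap ρ (ρ + 1) b < Equiv.swap ρ (ρ + 1) a ↔ b < a := by
  rw [Equiv.swap_apply_def, Equiv.swap_apply_def]
  split_ifs <;> omega

/-- A generic point minimizing the number of hyperplanes below it, among the generic points of its
face, satisfies the cadet condition. -/
theorem IsGenericIn.cadetCond (hA : A ⊆ catArr m n) (hx : IsGenericIn m A x)
    (hmin : ∀ y ∈ faceThrough A x, IsGenericIn m A y → ¬ numBelow m y < numBelow m x) :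
    CadetCond A (treeOf m x) (marksOf m x) := by
  intro i j s hcad him
  by_contra hcon
  push Not at hcon
  obtain ⟨hlab, hno⟩ := hcon
  have hμ := isMarking_marksOf m x
  set T := treeOf m x
  set μ := marksOf m x
  have hri := blockRank_cadet_of_notMem hcad him
  set r := blockRank T μ
  set ρ := r j with hρ
  let r' : Fin n → ℕ := fun a => Equiv.swap ρ (ρ + 1) (r a)
  have hr'le : ∀ a, r' a ≤ n := by
    intro a
    have h1 := blockRank_le T μ a
    have h2 := blockRank_le T μ i
    change r a ≤ n at h1
    change r i ≤ n at h2
    simp only [r', Equiv.swap_apply_def]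
    split_ifs <;> omega
  have hr'eq : ∀ a b, r' a = r' b ↔ simMu T μ a b := by
    intro a b
    rw [← blockRank_eq_iff hμ]
    exact (Equiv.swap ρ (ρ + 1)).injective.eq_iff
  have hxsim : ∀ a b, simMu T μ a b → x a - x b = (T.drift a : ℝ) - T.drift b :=
    fun a b h => sub_eq_of_simMu sub_eq_of_mem_marksOf h
  let y := ptOf T.drift r'
  have hysim : ∀ a b, simMu T μ a b → y a - y b = x a - x b := by
    intro a b h
    rw [hxsim a b h]
    have := (ptOf_eq_iff (d := T.drift) hr'le a b ((T.drift a : ℤ) - T.drift b)).2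
      ⟨by ring, ((hr'eq a b).2 h).symm⟩
    push_cast at this
    exact this
  have hi_of : ∀ a, r a = ρ + 1 → simMu T μ i a := fun a h =>
    (blockRank_eq_iff hμ).1 (hri.trans h.symm)
  have hj_of : ∀ a, r a = ρ → simMu T μ j a := fun a h => (blockRank_eq_iff hμ).1 h.symm
  have hlt : ∀ a b (c : ℤ), -(m : ℤ) ≤ c → c ≤ m → ¬ simMu T μ a b →
      ¬ ((T.drift b : ℤ) + c = T.drift a ∧
        ((r a = ρ ∧ r b = ρ + 1) ∨ (r a = ρ + 1 ∧ r b = ρ))) →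
      ((c : ℝ) < y a - y b ↔ (c : ℝ) < x a - x b) := by
    intro a b c hc hc' hs hsp
    rw [lt_sub_iff_above_treeOf hc hc' hs, ptOf_lt_iff hr'le, above_iff_blockRank hμ hs]
    by_cases heq : (T.drift b : ℤ) + c = T.drift a
    · have := swap_lt_swap_iff (ρ := ρ) (a := r a) (b := r b) (fun h => hsp ⟨heq, Or.inl h⟩)
        (fun h => hsp ⟨heq, Or.inr h⟩)
      rw [show r' b < r' a ↔ r b < r a from this]
    · simp [heq]
  have hns : ¬ simMu T μ i j := fun h => by
    have : r i = r j := (blockRank_eq_iff hμ).2 h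
    omega
  refine hmin y ?_ ?_ ?_
  · intro a b c hc
    obtain ⟨-, t, rfl, ht1, ht2⟩ := of_hyp_mem hA hc
    by_cases hs : simMu T μ a b
    · rw [hysim a b hs]
    · apply hlt a b t ht1 ht2 hs
      rintro ⟨heq, ⟨h1, h2⟩ | ⟨h1, h2⟩⟩
      · apply hno b a (hi_of b h2) (hj_of a h1)
        rw [hyp_symm] at hc
        convert hc using 2
        have : ((T.drift b : ℤ) : ℝ) + t = (T.drift a : ℤ) := by exact_mod_cast heq
        push_cast at this
        linarith
      · apply hno a b (hi_of a h1) (hj_of b h2)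
        convert hc using 2
        have : ((T.drift b : ℤ) : ℝ) + t = (T.drift a : ℤ) := by exact_mod_cast heq
        push_cast at this
        linarith
  · intro a b c _ _ h
    have hs : simMu T μ a b :=
      (hr'eq a b).1 ((ptOf_eq_iff (d := T.drift) hr'le a b c).1 h).2.symm
    refine Relation.ReflTransGen.mono (fun a b hab => ?_) _ _ (hx.reflTransGen_tight hs)
    rw [Tight, hysim a b (hab.simMu hA)]
    exact hab
  · have hdi := hcad.1.drift_eq
    have hsm := hcad.1.le
    apply Finset.card_lt_card
    rw [Finset.ssubset_iff_of_subset]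
    · refine ⟨(i, j, ⟨s, by omega⟩), ?_, ?_⟩
      · simp only [Finset.mem_filter, Finset.mem_univ, true_and]
        refine ⟨⟨hsm, hcad.1.ne, ?_⟩, ?_⟩
        · rcases Nat.eq_zero_or_pos s with h0 | h0
          · exact Or.inr (lt_of_le_of_ne (hlab h0) hcad.1.ne.symm)
          · exact Or.inl h0
        · have := (lt_sub_iff_above_treeOf (x := x) (m := m) (c := s) (by omega) (by omega) hns).2
            hcad.1.above
          simpa using this
      · simp only [Finset.mem_filter, Finset.mem_univ, true_and, not_and, not_lt]
        intro _
        have h1 := ptOf_lt_iff (d := T.drift) hr'le i j s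
        have h2 : r' i = ρ := by simp [r', hri]
        have h3 : r' j = ρ + 1 := by simp [r', ← hρ]
        rw [h2, h3] at h1
        have h4 : ¬ (((s : ℤ) : ℝ) < y i - y j) := by
          rw [h1]; omega
        simpa using h4
    · rintro ⟨a, b, t⟩
      simp only [Finset.mem_filter, Finset.mem_univ, true_and]
      rintro ⟨htr, hya⟩
      refine ⟨htr, ?_⟩
      by_cases hs : simMu T μ a b
      · rwa [hysim a b hs] at hya
      · have hya' : (((t.1 : ℕ) : ℤ) : ℝ) < y a - y b := by simpa using hya
        have hgoal : (((t.1 : ℕ) : ℤ) : ℝ) < x a - x b → ((t.1 : ℕ) : ℝ) < x a - x b := by simp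
        apply hgoal
        refine (hlt a b t.1 (by omega) (by omega) hs ?_).1 hya'
        rintro ⟨heq, h⟩
        rw [ptOf_lt_iff (d := T.drift) hr'le] at hya'
        have hr'lt : r' b < r' a := by omega
        rcases h with ⟨h1, h2⟩ | ⟨h1, h2⟩
        · have hb := (hi_of b h2).markedBelow_of_notMem hμ him
          have ha := (hj_of a h1).markedBelow_of_cadet_notMem hμ hcad him
          have hd1 := hb.drift_le
          have hd2 := ha.drift_le
          have hs0 : s = 0 := by omega
          have h5 := hb.le hμ (by omega)
          have h6 := ha.le hμ (by omega)
          have h7 : b < a := by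
            rcases htr.2.2 with h7 | h7
            · have h7 : 0 < t.1 := h7
              omega
            · exact h7
          have h8 := hlab hs0
          exact absurd (lt_of_le_of_lt h5 (lt_of_lt_of_le h7 h6)) (not_lt.2 h8)
        · have e1 : r' a = ρ := by simp [r', h1]
          have e2 : r' b = ρ + 1 := by simp [r', h2]
          omega

theorem exists_PhiBar_eq (hA : A ⊆ catArr m n) {F : Set (Fin n → ℝ)} (hF : IsFace n A F) :
    ∃ T μ, (T, μ) ∈ OTset m n A ∧ PhiBar m n A T μ = F := by
  obtain ⟨z, hz⟩ := hF.1
  obtain ⟨y, hy, hyg⟩ := exists_isGenericIn hA z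
  rw [← hF.eq_faceThrough hA hz] at hy
  obtain ⟨x, ⟨hxF, hxg⟩, hmin⟩ := (measure (numBelow m)).wf.has_min
    {x | x ∈ F ∧ IsGenericIn m A x} ⟨y, hy, hyg⟩
  have hFx := hF.eq_faceThrough hA hxF
  have hT : (treeOf m x, marksOf m x) ∈ OTset m n A :=
    ⟨isMarking_marksOf m x, hxg.aConnected hA,
      hxg.cadetCond hA fun w hw hwg => hmin w ⟨hFx ▸ hw, hwg⟩⟩
  exact ⟨_, _, hT, by rw [PhiBar_eq_faceThrough hA hT (mem_PhiBar_treeOf A), hFx]⟩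

end Braid

theorem faces_bijection (m n : ℕ) (A : Set (Set (Fin n → ℝ)))
    (hA : A ⊆ Braid.catArr m n) (hst : Braid.IsStronglyTransitive n A) :
    Set.BijOn (fun p : Braid.LTree m n × Set (Fin n) => Braid.PhiBar m n A p.1 p.2)
      (Braid.OTset m n A) {F | Braid.IsFace n A F} ∧
    ∀ p ∈ Braid.OTset m n A,
      p.2.ncard = Braid.faceCodim n (Braid.PhiBar m n A p.1 p.2) := by
  refine ⟨⟨?_, ?_, ?_⟩, fun p hp => Braid.ncard_eq_faceCodim hp.1⟩
  · rintro ⟨T, μ⟩ hT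
    exact Braid.isFace_PhiBar hA hT
  · rintro ⟨T, μ⟩ hT ⟨T', μ'⟩ hT' h
    obtain ⟨rfl, rfl⟩ := (Braid.sameFace_of_PhiBar_eq hA hT hT' h).eq hA hst
    rfl
  · intro F hF
    obtain ⟨T, μ, hT, h⟩ := Braid.exists_PhiBar_eq hA hF
    exact ⟨(T, μ), hT, h⟩
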